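/- arXiv:0912.4713 — 4 statements merged into one kernel-verified Lean document; each statement's English description precedes it below -/
import Mathlib

section
/- Assume Γ is finite and f_γ(ξ) = A_γ ξ for all ξ ∈ ℝⁿ, where A_γ ∈ ℝ^{n×n} for each γ ∈ Γ (so dom(f) = ℝⁿ × Γ). Let T be a family of forward complete trajectories of the switched system ẋ = A_σ x such that σ ∈ S_d ∩ S_e for every (x,σ) ∈ T. Suppose there exist a family {P_γ : γ ∈ Γ} of symmetric positive definite n×n real matrices and a family {C_γ : γ ∈ Γ} of real matrices with n columns such that: (1) P_γ A_γ + A_γᵀ P_γ ⪯ −C_γᵀ C_γ (in the Loewner order, i.e. ξᵀ(P_γA_γ + A_γᵀP_γ)ξ ≤ −|C_γξ|² for all ξ) for every γ ∈ Γ; (2) t ↦ x(t)ᵀ P_{σ(t)} x(t) is nonincreasing on [0,∞) for every (x,σ) ∈ T; (3) for every γ ∈ Γ, the unobservable subspace of (C_γ,A_γ), namely ∩_{k=0}^{n−1} ker(C_γ A_γᵏ), coincides with ker(A_γ); (4) ∩_{γ∈Γ} ker(A_γ) = {0}. Then T is globally asymptotically stable (GAS). -/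
open Filter Topology MeasureTheory Set

noncomputable section

abbrev Eucl (n : ℕ) : Type := EuclideanSpace ℝ (Fin n)

/-- The set of discontinuity (switching) times of a signal. -/
def JumpTimes {Γ : Type*} [TopologicalSpace Γ] (σ : ℝ → Γ) : Set ℝ :=
  {t | ¬ ContinuousAt σ t}

/-- A switching signal: piecewise constant (finitely many discontinuities in every
compact interval, locally constant to the right and on a left punctured neighborhood
of every point) and continuous from the right. -/
structure IsSwitchingSignal {Γ : Type*} [TopologicalSpace Γ] (σ : ℝ → Γ) : Prop where
  locFinite : ∀ a b : ℝ, (JumpTimes σ ∩ Set.Icc a b).Finite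
  rightConst : ∀ t : ℝ, ∃ ε > (0:ℝ), ∀ s ∈ Set.Ico t (t + ε), σ s = σ t
  leftConst : ∀ t : ℝ, ∃ ε > (0:ℝ), ∀ s ∈ Set.Ioo (t - ε) t, ∀ s' ∈ Set.Ioo (t - ε) t, σ s = σ s'

/-- `SA Γ τD N₀` : switching signals with average dwell time `τD` and chatter bound `N₀`. -/
def SA (Γ : Type*) [TopologicalSpace Γ] (τD : ℝ) (N₀ : ℕ) : Set (ℝ → Γ) :=
  {σ | IsSwitchingSignal σ ∧ ∀ τ₁ τ₂ : ℝ, τ₁ < τ₂ →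
    ((JumpTimes σ ∩ Set.Ioo τ₁ τ₂).ncard : ℝ) ≤ (N₀ : ℝ) + (τ₂ - τ₁) / τD}

def SAall (Γ : Type*) [TopologicalSpace Γ] : Set (ℝ → Γ) :=
  ⋃ τD ∈ Set.Ioi (0 : ℝ), ⋃ N₀ : ℕ, SA Γ τD N₀

/-- Dwell-time signals. -/
def SD (Γ : Type*) [TopologicalSpace Γ] (τD : ℝ) : Set (ℝ → Γ) := SA Γ τD 1

def SDall (Γ : Type*) [TopologicalSpace Γ] : Set (ℝ → Γ) :=
  ⋃ τD ∈ Set.Ioi (0 : ℝ), SD Γ τD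

/-- First switching time strictly greater than `t` (`⊤` if none). -/
def tau1 {Γ : Type*} [TopologicalSpace Γ] (σ : ℝ → Γ) (t : ℝ) : EReal :=
  sInf (Real.toEReal '' (JumpTimes σ ∩ Set.Ioi t))

/-- The class `S^H` of switching signals compatible with the set-valued map `H`:
at each switching time the new value belongs to `H` of the left limit. -/
def SH {Γ : Type*} [TopologicalSpace Γ] (H : Γ → Set Γ) : Set (ℝ → Γ) :=
  {σ | ∀ t ∈ JumpTimes σ, ∀ γ' : Γ,
    Filter.Tendsto σ (nhdsWithin t (Set.Iio t)) (nhds γ') → σ t ∈ H γ'}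

/-- The "ergodic" class `S_e[T]`. -/
def SE (Γ : Type*) [TopologicalSpace Γ] (T : ℝ) : Set (ℝ → Γ) :=
  {σ | ∀ t₀ : ℝ, 0 ≤ t₀ → ∀ γ : Γ, ∃ t ∈ Set.Icc t₀ (t₀ + T), σ t = γ}

def SEall (Γ : Type*) [TopologicalSpace Γ] : Set (ℝ → Γ) :=
  ⋃ T ∈ Set.Ioi (0 : ℝ), SE Γ T

/-- Property P of a family of switching signals. -/
def HasPropertyP {Γ : Type*} [TopologicalSpace Γ] (S : Set (ℝ → Γ)) : Prop :=
  (∃ τD > (0 : ℝ), ∃ N₀ : ℕ, S ⊆ SA Γ τD N₀) ∧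
  (∀ σ ∈ S, ∀ s > (0 : ℝ), (fun t => σ (t + s)) ∈ S) ∧
  (∀ σseq : ℕ → ℝ → Γ, (∀ k, σseq k ∈ S) →
    ∃ σstar ∈ S, ∃ φ : ℕ → ℕ, StrictMono φ ∧
      ∀ᵐ t ∂(volume : Measure ℝ),
        Filter.Tendsto (fun l => σseq (φ l) t) Filter.atTop (nhds (σstar t)))

/-- A solution of `ẋ = g(x)` with values in `X`, on the set `I`. -/
def IsSolOn {n : ℕ} (g : Eucl n → Eucl n) (X : Set (Eucl n)) (φ : ℝ → Eucl n) (I : Set ℝ) : Prop :=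
  ContinuousOn φ I ∧ (∀ t ∈ I, φ t ∈ X) ∧
  ∀ t₀ ∈ I, ∀ t ∈ I,
    IntervalIntegrable (fun s => g (φ s)) volume t₀ t ∧
    φ t = φ t₀ + ∫ s in t₀..t, g (φ s)

/-- A trajectory of the switched system `ẋ = f(x,σ)` on the interval `I`. -/
structure IsTrajectory {n : ℕ} {Γ : Type*} [TopologicalSpace Γ]
    (f : Eucl n × Γ → Eucl n) (domf : Set (Eucl n × Γ))
    (x : ℝ → Eucl n) (σ : ℝ → Γ) (I : Set ℝ) : Prop where
  signal : IsSwitchingSignal σ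
  nonempty : I.Nonempty
  ordConn : I.OrdConnected
  cont : ContinuousOn x I
  mem : ∀ t ∈ I, (x t, σ t) ∈ domf
  intg : ∀ t₀ ∈ I, ∀ t ∈ I,
    IntervalIntegrable (fun s => f (x s, σ s)) volume t₀ t ∧
    x t = x t₀ + ∫ s in t₀..t, f (x s, σ s)

/-- Precompactness of a trajectory relative to `O`. -/
def PrecompactRel {n : ℕ} (x : ℝ → Eucl n) (I : Set ℝ) (O : Set (Eucl n)) : Prop :=
  ∃ B : Set (Eucl n), B ⊆ O ∧ IsCompact B ∧ ∀ t ∈ I, x t ∈ B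

/-- ω-limit set of `x` defined on `I`. -/
def OmegaLimit {n : ℕ} (x : ℝ → Eucl n) (I : Set ℝ) : Set (Eucl n) :=
  {ξ | ∃ s : ℕ → ℝ, StrictMono s ∧ (∀ k, s k ∈ I) ∧
    Filter.Tendsto s Filter.atTop Filter.atTop ∧
    Filter.Tendsto (fun k => x (s k)) Filter.atTop (nhds ξ)}

/-- The set `Ω♯(x,σ)`. -/
def OmegaSharp {n : ℕ} {Γ : Type*} [TopologicalSpace Γ] (x : ℝ → Eucl n) (σ : ℝ → Γ) :
    Set (Eucl n × Γ) :=
  {p | ∃ s : ℕ → ℝ, StrictMono s ∧ (∀ k, 0 ≤ s k) ∧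
    Filter.Tendsto s Filter.atTop Filter.atTop ∧
    (∃ r : EReal, 0 < r ∧
      Filter.Tendsto (fun k => tau1 σ (s k) - Real.toEReal (s k)) Filter.atTop (nhds r)) ∧
    Filter.Tendsto (fun k => x (s k)) Filter.atTop (nhds p.1) ∧
    Filter.Tendsto (fun k => σ (s k)) Filter.atTop (nhds p.2)}

/-- Weak invariance of `M` w.r.t. the family of complete trajectories `T`
(without the nonemptiness requirement). -/
def WeaklyInvariantCore {n : ℕ} {Γ : Type*} (T : Set ((ℝ → Eucl n) × (ℝ → Γ)))
    (M : Set (Eucl n × Γ)) : Prop :=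
  ∀ p ∈ M, ∃ xs ∈ T, xs.1 0 = p.1 ∧ xs.2 0 = p.2 ∧ ∀ t : ℝ, (xs.1 t, xs.2 t) ∈ M

/-- Weak invariance of a nonempty set `M` w.r.t. `T`. -/
def WeaklyInvariant {n : ℕ} {Γ : Type*} (T : Set ((ℝ → Eucl n) × (ℝ → Γ)))
    (M : Set (Eucl n × Γ)) : Prop :=
  M.Nonempty ∧ WeaklyInvariantCore T M

/-- Maximal weakly invariant subset of `S` w.r.t. `T`. -/
def MaxWeaklyInvariantIn {n : ℕ} {Γ : Type*} (T : Set ((ℝ → Eucl n) × (ℝ → Γ)))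
    (S : Set (Eucl n × Γ)) : Set (Eucl n × Γ) :=
  ⋃₀ {M | M ⊆ S ∧ WeaklyInvariantCore T M}

/-- All complete trajectories whose switching signal lies in `S`. -/
def TrajOf {n : ℕ} {Γ : Type*} [TopologicalSpace Γ] (f : Eucl n × Γ → Eucl n)
    (domf : Set (Eucl n × Γ)) (S : Set (ℝ → Γ)) : Set ((ℝ → Eucl n) × (ℝ → Γ)) :=
  {xs | IsTrajectory f domf xs.1 xs.2 Set.univ ∧ xs.2 ∈ S}

/-- `x → M` : convergence of `x(t)` to the set `M` as `t → +∞`. -/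
def ConvergesTo {n : ℕ} (x : ℝ → Eucl n) (M : Set (Eucl n)) : Prop :=
  Filter.Tendsto (fun t => Metric.infDist (x t) M) Filter.atTop (nhds 0)

def Oset {n : ℕ} {Γ : Type*} (domV : Set (Eucl n × Γ)) : Set (Eucl n) := Prod.fst '' domV

def Ogamma {n : ℕ} {Γ : Type*} (domV domf : Set (Eucl n × Γ)) (γ : Γ) : Set (Eucl n) :=
  {ξ | ξ ∈ Oset domV ∧ (ξ, γ) ∈ domf}

/-- The class 𝒱 of functions. -/
structure ClassVFun {n : ℕ} {Γ : Type*} (V : Eucl n × Γ → ℝ)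
    (domV domf : Set (Eucl n × Γ)) : Prop where
  openD : ∀ γ : Γ, IsOpen {ξ : Eucl n | (ξ, γ) ∈ domV}
  subD : ∀ γ : Γ, ∀ ξ ∈ Ogamma domV domf γ, (ξ, γ) ∈ domV
  diff : ∀ γ : Γ, ∀ ξ ∈ Ogamma domV domf γ, DifferentiableAt ℝ (fun ξ' => V (ξ', γ)) ξ

/-- The set `Z_V`. -/
def ZV {n : ℕ} {Γ : Type*} (f : Eucl n × Γ → Eucl n) (V : Eucl n × Γ → ℝ)
    (domV domf : Set (Eucl n × Γ)) : Set (Eucl n × Γ) :=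
  {p | p ∈ domf ∧ p.1 ∈ Oset domV ∧ fderiv ℝ (fun ξ' => V (ξ', p.2)) p.1 (f p) = 0}

/-- Assumption (A1). -/
structure AssumptionA1 {n : ℕ} {Γ : Type*} [TopologicalSpace Γ]
    (domf : Set (Eucl n × Γ)) (V : Eucl n × Γ → ℝ) (domV : Set (Eucl n × Γ))
    (x : ℝ → Eucl n) (σ : ℝ → Γ) (I : Set ℝ) : Prop where
  classV : ClassVFun V domV domf
  contV : ContinuousOn V (domf ∩ (Oset domV ×ˢ (Set.univ : Set Γ)))
  precompact : PrecompactRel x I (Oset domV)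
  nonincr : AntitoneOn (fun t => V (x t, σ t)) (Set.Ici 0)

/-- Assumption (A2) (for finite Γ). -/
structure AssumptionA2 {n : ℕ} {Γ : Type*} [TopologicalSpace Γ]
    (domf : Set (Eucl n × Γ)) (V : Eucl n × Γ → ℝ) (domV : Set (Eucl n × Γ))
    (x : ℝ → Eucl n) (σ : ℝ → Γ) (I : Set ℝ) : Prop where
  classV : ClassVFun V domV domf
  precompact : PrecompactRel x I (Oset domV)
  nonincr : ∀ γ : Γ, AntitoneOn (fun t => V (x t, σ t)) ({t | σ t = γ} ∩ Set.Ici 0)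

/-- The inequality `−∇V_γ(ξ)·f_γ(ξ) ≥ W_γ(ξ) ≥ 0` on each `O_γ`. -/
def Wineq {n : ℕ} {Γ : Type*} (f : Eucl n × Γ → Eucl n) (V W : Eucl n × Γ → ℝ)
    (domV domf : Set (Eucl n × Γ)) : Prop :=
  ∀ γ : Γ, ∀ ξ ∈ Ogamma domV domf γ,
    W (ξ, γ) ≤ -(fderiv ℝ (fun ξ' => V (ξ', γ)) ξ (f (ξ, γ))) ∧ 0 ≤ W (ξ, γ)

/-- Assumption (A4). -/
structure AssumptionA4 {n : ℕ} {Γ : Type*} [TopologicalSpace Γ] (f : Eucl n × Γ → Eucl n)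
    (domf : Set (Eucl n × Γ)) (V : Eucl n × Γ → ℝ) (domV : Set (Eucl n × Γ))
    (W : Eucl n × Γ → ℝ) (x : ℝ → Eucl n) (σ : ℝ → Γ) (I : Set ℝ) : Prop where
  classV : ClassVFun V domV domf
  boundedV : ∀ K : Set (Eucl n × Γ), K ⊆ domf ∩ (Oset domV ×ˢ (Set.univ : Set Γ)) →
    IsCompact K → ∃ M : ℝ, ∀ p ∈ K, |V p| ≤ M
  precompact : PrecompactRel x I (Oset domV)
  nonincr : AntitoneOn (fun t => V (x t, σ t)) (Set.Ici 0)
  wineq : Wineq f V W domV domf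
  contW : ContinuousOn W (domf ∩ (Oset domV ×ˢ (Set.univ : Set Γ)))

/-- The set `X^f(g,h,τ)` for finite `τ`. -/
def XFwd {n : ℕ} (X : Set (Eucl n)) (g : Eucl n → Eucl n) (h : Eucl n → ℝ) (τ : ℝ) :
    Set (Eucl n) :=
  {ξ | ∃ φ : ℝ → Eucl n, IsSolOn g X φ (Set.Icc 0 τ) ∧ φ 0 = ξ ∧
    ∀ t ∈ Set.Icc (0 : ℝ) τ, h (φ t) = 0}

/-- The set `X^b(g,h,τ)` for finite `τ`. -/
def XBwd {n : ℕ} (X : Set (Eucl n)) (g : Eucl n → Eucl n) (h : Eucl n → ℝ) (τ : ℝ) :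
    Set (Eucl n) :=
  {ξ | ∃ φ : ℝ → Eucl n, IsSolOn g X φ (Set.Icc (-τ) 0) ∧ φ 0 = ξ ∧
    ∀ t ∈ Set.Icc (-τ) (0 : ℝ), h (φ t) = 0}

/-- The set `X^f(g,h,∞)`. -/
def XFwdInf {n : ℕ} (X : Set (Eucl n)) (g : Eucl n → Eucl n) (h : Eucl n → ℝ) :
    Set (Eucl n) :=
  {ξ | ∃ φ : ℝ → Eucl n, IsSolOn g X φ (Set.Ici 0) ∧ φ 0 = ξ ∧
    ∀ t ∈ Set.Ici (0 : ℝ), h (φ t) = 0}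

/-- The set `X^b(g,h,∞)`. -/
def XBwdInf {n : ℕ} (X : Set (Eucl n)) (g : Eucl n → Eucl n) (h : Eucl n → ℝ) :
    Set (Eucl n) :=
  {ξ | ∃ φ : ℝ → Eucl n, IsSolOn g X φ (Set.Iic 0) ∧ φ 0 = ξ ∧
    ∀ t ∈ Set.Iic (0 : ℝ), h (φ t) = 0}

/-- `X^f(g,h) = ∪_{τ>0} X^f(g,h,τ)`. -/
def XFwdFin {n : ℕ} (X : Set (Eucl n)) (g : Eucl n → Eucl n) (h : Eucl n → ℝ) :
    Set (Eucl n) :=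
  ⋃ τ ∈ Set.Ioi (0 : ℝ), XFwd X g h τ

/-- `X^b(g,h) = ∪_{τ>0} X^b(g,h,τ)`. -/
def XBwdFin {n : ℕ} (X : Set (Eucl n)) (g : Eucl n → Eucl n) (h : Eucl n → ℝ) :
    Set (Eucl n) :=
  ⋃ τ ∈ Set.Ioi (0 : ℝ), XBwd X g h τ

/-- Weakly meagre functions on `[0,∞)`. -/
def WeaklyMeagre (y : ℝ → ℝ) : Prop :=
  ∀ I : ℕ → Set ℝ, (∀ k, (I k).Nonempty) → (∀ k, I k ⊆ Set.Ici 0) →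
    (∀ k, (I k).OrdConnected) → (Pairwise fun k l => Disjoint (I k) (I l)) →
    (∃ δ : ENNReal, 0 < δ ∧ ∀ k, δ ≤ volume (I k)) →
    Filter.Tendsto (fun k => sInf ((fun t => |y t|) '' I k)) Filter.atTop (nhds 0)

/-- Assumption (E0) : the origin is an equilibrium point of the switched system. -/
def AssumpE0 {n : ℕ} {Γ : Type*} (f : Eucl n × Γ → Eucl n) (domf : Set (Eucl n × Γ)) : Prop :=
  ∀ γ : Γ, ((0 : Eucl n), γ) ∈ domf → f (0, γ) = 0

/-- Assumption (U) : uniqueness of the solution of the IVP `ẋ = f_γ(x)`, `x(0)=0`. -/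
def AssumpU {n : ℕ} {Γ : Type*} (f : Eucl n × Γ → Eucl n) (domf : Set (Eucl n × Γ)) : Prop :=
  ∀ γ : Γ, ((0 : Eucl n), γ) ∈ domf →
    ∀ I : Set ℝ, I.OrdConnected → (0 : ℝ) ∈ I →
    ∀ φ ψ : ℝ → Eucl n,
      IsSolOn (fun ξ => f (ξ, γ)) {ξ | (ξ, γ) ∈ domf} φ I →
      IsSolOn (fun ξ => f (ξ, γ)) {ξ | (ξ, γ) ∈ domf} ψ I →
      φ 0 = 0 → ψ 0 = 0 → ∀ t ∈ I, φ t = ψ t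

/-- The set `E_γ` of equilibrium points of `f_γ`. -/
def Egamma {n : ℕ} {Γ : Type*} (f : Eucl n × Γ → Eucl n) (domf : Set (Eucl n × Γ)) (γ : Γ) :
    Set (Eucl n) :=
  {ξ | (ξ, γ) ∈ domf ∧ f (ξ, γ) = 0}

/-- Discrete subsets of `ℝⁿ`. -/
def IsDiscreteSet {n : ℕ} (S : Set (Eucl n)) : Prop :=
  ∀ ξ ∈ S, ∃ ε > (0 : ℝ), S ∩ Metric.ball ξ ε = {ξ}

/-- Class-K functions (on `[0,∞)`). -/
structure ClassK (α : ℝ → ℝ) : Prop where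
  cont : ContinuousOn α (Set.Ici 0)
  mono : StrictMonoOn α (Set.Ici 0)
  zero : α 0 = 0

/-- Class-K∞ functions. -/
structure ClassKInf (α : ℝ → ℝ) extends ClassK α : Prop where
  unbounded : Filter.Tendsto α Filter.atTop Filter.atTop

/-- Local uniform stability of a family of forward complete trajectories. -/
def FamilyLUS {n : ℕ} {Γ : Type*} (T : Set ((ℝ → Eucl n) × (ℝ → Γ))) : Prop :=
  ∃ r > (0 : ℝ), ∃ α : ℝ → ℝ, ClassK α ∧
    ∀ xs ∈ T, ∀ t₀ : ℝ, 0 ≤ t₀ → ‖xs.1 t₀‖ ≤ r → ∀ t : ℝ, t₀ ≤ t → ‖xs.1 t‖ ≤ α ‖xs.1 t₀‖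

/-- Global uniform stability. -/
def FamilyGUS {n : ℕ} {Γ : Type*} (T : Set ((ℝ → Eucl n) × (ℝ → Γ))) : Prop :=
  ∃ α : ℝ → ℝ, ClassKInf α ∧
    ∀ xs ∈ T, ∀ t₀ : ℝ, 0 ≤ t₀ → ∀ t : ℝ, t₀ ≤ t → ‖xs.1 t‖ ≤ α ‖xs.1 t₀‖

/-- Local asymptotic stability. -/
def FamilyLAS {n : ℕ} {Γ : Type*} (T : Set ((ℝ → Eucl n) × (ℝ → Γ))) : Prop :=
  FamilyLUS T ∧ ∃ η > (0 : ℝ), ∀ xs ∈ T, ‖xs.1 0‖ < η →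
    Filter.Tendsto xs.1 Filter.atTop (nhds 0)

/-- Global asymptotic stability. -/
def FamilyGAS {n : ℕ} {Γ : Type*} (T : Set ((ℝ → Eucl n) × (ℝ → Γ))) : Prop :=
  FamilyGUS T ∧ ∀ xs ∈ T, Filter.Tendsto xs.1 Filter.atTop (nhds 0)

/-- A weak Lyapunov pair `(V,W)` for the family `T`. -/
structure WeakLyapunovPair {n : ℕ} {Γ : Type*} [TopologicalSpace Γ]
    (f : Eucl n × Γ → Eucl n) (domf : Set (Eucl n × Γ)) (V : Eucl n × Γ → ℝ)
    (domV : Set (Eucl n × Γ)) (W : Eucl n × Γ → ℝ)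
    (T : Set ((ℝ → Eucl n) × (ℝ → Γ))) : Prop where
  classV : ClassVFun V domV domf
  zeroMem : (0 : Eucl n) ∈ Oset domV
  bounds : ∃ α₁ α₂ : ℝ → ℝ, ClassK α₁ ∧ ClassK α₂ ∧
    ∀ γ : Γ, ∀ ξ ∈ Ogamma domV domf γ, α₁ ‖ξ‖ ≤ V (ξ, γ) ∧ V (ξ, γ) ≤ α₂ ‖ξ‖
  wineq : Wineq f V W domV domf
  decreasing : ∀ xs ∈ T, ∀ a b : ℝ, 0 ≤ a → a ≤ b →
    (∀ t ∈ Set.Icc a b, xs.1 t ∈ Oset domV) →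
    AntitoneOn (fun t => V (xs.1 t, xs.2 t)) (Set.Icc a b)

/-- An F-weak Lyapunov pair `(V,W)` for the family `T`. -/
structure FWeakLyapunovPair {n : ℕ} {Γ : Type*} [TopologicalSpace Γ]
    (f : Eucl n × Γ → Eucl n) (domf : Set (Eucl n × Γ)) (V : Eucl n × Γ → ℝ)
    (domV : Set (Eucl n × Γ)) (W : Eucl n × Γ → ℝ)
    (T : Set ((ℝ → Eucl n) × (ℝ → Γ))) : Prop where
  classV : ClassVFun V domV domf
  zeroMem : (0 : Eucl n) ∈ Oset domV
  bounds : ∃ α₁ α₂ : ℝ → ℝ, ClassK α₁ ∧ ClassK α₂ ∧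
    ∀ γ : Γ, ∀ ξ ∈ Ogamma domV domf γ, α₁ ‖ξ‖ ≤ V (ξ, γ) ∧ V (ξ, γ) ≤ α₂ ‖ξ‖
  wineq : Wineq f V W domV domf
  decreasing : ∀ xs ∈ T, ∀ a b : ℝ, 0 ≤ a → a ≤ b →
    (∀ t ∈ Set.Icc a b, xs.1 t ∈ Oset domV) →
    ∀ γ : Γ, AntitoneOn (fun t => V (xs.1 t, γ)) (Set.Icc a b ∩ {t | xs.2 t = γ})

/-- `V` is radially unbounded : the class-K bounds may be chosen of class K∞. -/
def RadiallyUnbounded {n : ℕ} {Γ : Type*} (V : Eucl n × Γ → ℝ)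
    (domV domf : Set (Eucl n × Γ)) : Prop :=
  ∃ α₁ α₂ : ℝ → ℝ, ClassKInf α₁ ∧ ClassKInf α₂ ∧
    ∀ γ : Γ, ∀ ξ ∈ Ogamma domV domf γ, α₁ ‖ξ‖ ≤ V (ξ, γ) ∧ V (ξ, γ) ≤ α₂ ‖ξ‖

/-- Simple cycle `{γ_i}_{i=1}^m` of the set-valued map `H`. -/
def IsSimpleCycle {Γ : Type*} (H : Γ → Set Γ) (m : ℕ) (γs : ℕ → Γ) : Prop :=
  3 ≤ m ∧ γs 1 = γs m ∧ (∀ i, 1 ≤ i → i < m → γs (i + 1) ∈ H (γs i)) ∧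
  ∀ i j, 1 ≤ i → i < j → j ≤ m → γs i = γs j → i = 1 ∧ j = m

/-- A family of forward complete trajectories of the switched system. -/
def ForwardCompleteFamily {n : ℕ} {Γ : Type*} [TopologicalSpace Γ]
    (f : Eucl n × Γ → Eucl n) (domf : Set (Eucl n × Γ))
    (T : Set ((ℝ → Eucl n) × (ℝ → Γ))) : Prop :=
  ∀ xs ∈ T, ∃ I : Set ℝ, Set.Ici (0 : ℝ) ⊆ I ∧ IsTrajectory f domf xs.1 xs.2 I

/-- Condition (a) : `O_γ^f(f_γ,W_γ,∞) ∩ O_γ^b(f_γ,W_γ,∞) ⊆ {0}` for every `γ`. -/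
def CondA {n : ℕ} {Γ : Type*} (f : Eucl n × Γ → Eucl n)
    (domf domV : Set (Eucl n × Γ)) (W : Eucl n × Γ → ℝ) : Prop :=
  ∀ γ : Γ, XFwdInf (Ogamma domV domf γ) (fun ξ => f (ξ, γ)) (fun ξ => W (ξ, γ)) ∩
    XBwdInf (Ogamma domV domf γ) (fun ξ => f (ξ, γ)) (fun ξ => W (ξ, γ)) ⊆ {0}

/-- Condition (b) : `O_γ^b(f_γ,W_γ) ∩ O_{γ'}^f(f_{γ'},W_{γ'}) ⊆ {0}` for `γ ≠ γ'`. -/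
def CondB {n : ℕ} {Γ : Type*} (f : Eucl n × Γ → Eucl n)
    (domf domV : Set (Eucl n × Γ)) (W : Eucl n × Γ → ℝ) : Prop :=
  ∀ γ γ' : Γ, γ ≠ γ' →
    XBwdFin (Ogamma domV domf γ) (fun ξ => f (ξ, γ)) (fun ξ => W (ξ, γ)) ∩
    XFwdFin (Ogamma domV domf γ') (fun ξ => f (ξ, γ')) (fun ξ => W (ξ, γ')) ⊆ {0}

/-- Condition (b') : the variant of (b) involving the level sets of `V`. -/
def CondB' {n : ℕ} {Γ : Type*} (f : Eucl n × Γ → Eucl n) (V : Eucl n × Γ → ℝ)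
    (domf domV : Set (Eucl n × Γ)) (W : Eucl n × Γ → ℝ) : Prop :=
  ∀ γ γ' : Γ, γ ≠ γ' → ∀ c : ℝ,
    XBwdFin (Ogamma domV domf γ) (fun ξ => f (ξ, γ)) (fun ξ => W (ξ, γ)) ∩
    XFwdFin (Ogamma domV domf γ') (fun ξ => f (ξ, γ')) (fun ξ => W (ξ, γ')) ∩
    {ξ : Eucl n | V (ξ, γ) = c} ∩ {ξ : Eucl n | V (ξ, γ') = c} ⊆ {0}

/-- Condition (i) of the cycle theorems :
either all the forward infinite-horizon sets, or all the backward ones, reduce to `{0}`. -/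
def CondI {n : ℕ} {Γ : Type*} (f : Eucl n × Γ → Eucl n)
    (domf domV : Set (Eucl n × Γ)) (W : Eucl n × Γ → ℝ) : Prop :=
  (∀ γ : Γ, XFwdInf (Ogamma domV domf γ) (fun ξ => f (ξ, γ)) (fun ξ => W (ξ, γ)) ⊆ {0}) ∨
  (∀ γ : Γ, XBwdInf (Ogamma domV domf γ) (fun ξ => f (ξ, γ)) (fun ξ => W (ξ, γ)) ⊆ {0})

/-- Condition (ii) on simple cycles of `H`. -/
def CondCycle {n : ℕ} {Γ : Type*} (f : Eucl n × Γ → Eucl n)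
    (domf domV : Set (Eucl n × Γ)) (W : Eucl n × Γ → ℝ) (H : Γ → Set Γ) : Prop :=
  ∀ m : ℕ, ∀ γs : ℕ → Γ, IsSimpleCycle H m γs →
    ∃ j : ℕ, 1 ≤ j ∧ j < m ∧
      XBwdFin (Ogamma domV domf (γs j)) (fun ξ => f (ξ, γs j)) (fun ξ => W (ξ, γs j)) ∩
      XFwdFin (Ogamma domV domf (γs (j + 1))) (fun ξ => f (ξ, γs (j + 1)))
        (fun ξ => W (ξ, γs (j + 1))) ⊆ {0}

/-- Condition (iii) on simple cycles of `H`, involving the level sets of `V`. -/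
def CondCycle' {n : ℕ} {Γ : Type*} (f : Eucl n × Γ → Eucl n) (V : Eucl n × Γ → ℝ)
    (domf domV : Set (Eucl n × Γ)) (W : Eucl n × Γ → ℝ) (H : Γ → Set Γ) : Prop :=
  ∀ c : ℝ, ∀ m : ℕ, ∀ γs : ℕ → Γ, IsSimpleCycle H m γs →
    ∃ j : ℕ, 1 ≤ j ∧ j < m ∧
      XBwdFin (Ogamma domV domf (γs j)) (fun ξ => f (ξ, γs j)) (fun ξ => W (ξ, γs j)) ∩
      XFwdFin (Ogamma domV domf (γs (j + 1))) (fun ξ => f (ξ, γs (j + 1)))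
        (fun ξ => W (ξ, γs (j + 1))) ∩
      {ξ : Eucl n | V (ξ, γs j) = c} ∩ {ξ : Eucl n | V (ξ, γs (j + 1)) = c} ⊆ {0}

/-- For every `γ`, `O_γ^b(f_γ,W_γ) = E_γ ∩ O_γ` or `O_γ^f(f_γ,W_γ) = E_γ ∩ O_γ`. -/
def CondEquilObs {n : ℕ} {Γ : Type*} (f : Eucl n × Γ → Eucl n)
    (domf domV : Set (Eucl n × Γ)) (W : Eucl n × Γ → ℝ) : Prop :=
  ∀ γ : Γ,
    XBwdFin (Ogamma domV domf γ) (fun ξ => f (ξ, γ)) (fun ξ => W (ξ, γ)) =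
      Egamma f domf γ ∩ Ogamma domV domf γ ∨
    XFwdFin (Ogamma domV domf γ) (fun ξ => f (ξ, γ)) (fun ξ => W (ξ, γ)) =
      Egamma f domf γ ∩ Ogamma domV domf γ

end

section Aux

set_option linter.unusedSectionVars false

/-- Compactness comparison lemma. -/
lemma aux_compact {E : Type*} [TopologicalSpace E] {K : Set E} (hK : IsCompact K)
    {G H : E → ℝ} (hG : Continuous G) (hH : Continuous H)
    (hG0 : ∀ ξ, 0 ≤ G ξ) (hGH : ∀ ξ, G ξ = 0 → H ξ = 0) {ε : ℝ} (hε : 0 < ε) :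
    ∃ η > 0, ∀ ξ ∈ K, G ξ < η → H ξ < ε := by
  have hc : IsCompact (K ∩ {ξ | ε ≤ H ξ}) := hK.inter_right (isClosed_le continuous_const hH)
  obtain ⟨η, hη, h⟩ := hc.exists_forall_le' hG.continuousOn (a := 0) (by
    rintro ξ ⟨_, hξ⟩
    rcases (hG0 ξ).lt_or_eq with h | h
    · exact h
    · have := hGH ξ h.symm
      simp only [Set.mem_ofPred_eq] at hξ
      linarith)
  refine ⟨η, hη, fun ξ hξ hlt => ?_⟩
  by_contra hcon
  have := h ξ ⟨hξ, not_lt.1 hcon⟩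
  linarith

/-- A positive lower bound for finitely many positive numbers. -/
lemma aux_min {Γ : Type*} [Finite Γ] (c : Γ → ℝ) (hc : ∀ γ, 0 < c γ) :
    ∃ d > 0, ∀ γ, d ≤ c γ := by
  rcases isEmpty_or_nonempty Γ with h | h
  · exact ⟨1, one_pos, fun γ => (h.false γ).elim⟩
  · obtain ⟨γ, hγ⟩ := Finite.exists_min c
    exact ⟨c γ, hc γ, hγ⟩

variable {E : Type*} [NormedAddCommGroup E] [InnerProductSpace ℝ E] [CompleteSpace E]

/-- The flow of a linear vector field. -/
noncomputable def auxFlow (L : E →L[ℝ] E) (u : ℝ) (ξ : E) : E := NormedSpace.exp (u • L) ξ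

lemma auxFlow_zero (L : E →L[ℝ] E) (ξ : E) : auxFlow L 0 ξ = ξ := by
  simp [auxFlow]

lemma auxFlow_deriv (L : E →L[ℝ] E) (ξ : E) (u : ℝ) :
    HasDerivAt (fun u => auxFlow L u ξ) (L (auxFlow L u ξ)) u := by
  have h := hasDerivAt_exp_smul_const' (𝕂 := ℝ) L u
  exact ((ContinuousLinearMap.apply ℝ E ξ).hasFDerivAt.comp_hasDerivAt u h)

lemma auxFlow_cont (L : E →L[ℝ] E) (u : ℝ) : Continuous (auxFlow L u) :=
  (NormedSpace.exp (u • L)).continuous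

lemma aux_unique (L : E →L[ℝ] E) {x : ℝ → E} {a b : ℝ} (hab : a ≤ b)
    (hc : ContinuousOn x (Icc a b))
    (hx : ∀ t ∈ Icc a b, x t = x a + ∫ s in a..t, L (x s)) :
    x b = auxFlow L (b - a) (x a) := by
  set y : ℝ → E := IccExtend hab ((Icc a b).domRestrict x) with hy
  have hyc : Continuous y := (continuousOn_iff_continuous_domRestrict.1 hc).Icc_extend'
  have hyx : ∀ t ∈ Icc a b, y t = x t := fun t ht => by
    rw [hy, IccExtend_of_mem _ _ ht]; rfl
  set z : ℝ → E := fun t => x a + ∫ s in a..t, L (y s) with hz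
  have hLy : Continuous (fun s => L (y s)) := L.continuous.comp hyc
  have hzd : ∀ t, HasDerivAt z (L (y t)) t := fun t => by
    have := intervalIntegral.integral_hasDerivAt_right (hLy.intervalIntegrable a t)
      hLy.aestronglyMeasurable.stronglyMeasurableAtFilter hLy.continuousAt
    exact this.const_add (x a)
  have hzx : ∀ t ∈ Icc a b, z t = x t := fun t ht => by
    rw [hx t ht]
    change x a + _ = x a + _
    congr 1
    apply intervalIntegral.integral_congr
    intro s hs
    rw [uIcc_of_le ht.1] at hs
    simp only
    rw [hyx s ⟨hs.1, hs.2.trans ht.2⟩]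
  have hwd : ∀ t, HasDerivAt (fun t => auxFlow L (t - a) (x a)) (L (auxFlow L (t - a) (x a))) t := by
    intro t
    have h1 := auxFlow_deriv L (x a) (t - a)
    exact h1.comp_sub_const t a
  have := ODE_solution_unique_of_mem_Icc_right (v := fun _ => L) (s := fun _ => univ)
    (K := ‖L‖₊) (f := z) (g := fun t => auxFlow L (t - a) (x a)) (a := a) (b := b)
    (fun t _ => L.lipschitz.lipschitzOnWith)
    (fun t _ => (hzd t).continuousAt.continuousWithinAt)
    (fun t ht => by
      have h := (hzd t).hasDerivWithinAt (s := Ici t)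
      rwa [hyx t (Ico_subset_Icc_self ht), ← hzx t (Ico_subset_Icc_self ht)] at h)
    (fun _ _ => mem_univ _)
    (fun t _ => (hwd t).continuousAt.continuousWithinAt)
    (fun t ht => (hwd t).hasDerivWithinAt)
    (fun _ _ => mem_univ _)
    (by simp [hz, auxFlow_zero])
  have hb := this (right_mem_Icc.2 hab)
  rw [hzx b (right_mem_Icc.2 hab)] at hb
  exact hb

section Obs
variable {F : Type*} [NormedAddCommGroup F] [NormedSpace ℝ F]
  (L M : E →L[ℝ] E) (C : E →L[ℝ] F) (w : E → ℝ)

lemma auxV_deriv (ξ : E) (u : ℝ) :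
    HasDerivAt (fun u => inner ℝ (auxFlow L u ξ) (M (auxFlow L u ξ)))
      (inner ℝ (auxFlow L u ξ) (M (L (auxFlow L u ξ))) +
        inner ℝ (L (auxFlow L u ξ)) (M (auxFlow L u ξ))) u := by
  have h := auxFlow_deriv L ξ u
  exact h.inner ℝ (M.hasFDerivAt.comp_hasDerivAt u h)

lemma auxV_anti (hw0 : ∀ ξ, 0 ≤ w ξ)
    (hw : ∀ ξ, inner ℝ ξ (M (L ξ)) + inner ℝ (L ξ) (M ξ) ≤ - w ξ) (ξ : E) :
    Antitone (fun u => inner ℝ (auxFlow L u ξ) (M (auxFlow L u ξ))) := by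
  apply antitone_of_deriv_nonpos
  · intro u; exact (auxV_deriv L M ξ u).differentiableAt
  · intro u
    rw [(auxV_deriv L M ξ u).deriv]
    have := hw (auxFlow L u ξ)
    have := hw0 (auxFlow L u ξ)
    linarith

lemma aux_obs (N : ℕ) (hw0 : ∀ ξ, 0 ≤ w ξ) (hwC : ∀ ξ, w ξ = 0 → C ξ = 0)
    (hw : ∀ ξ, inner ℝ ξ (M (L ξ)) + inner ℝ (L ξ) (M ξ) ≤ - w ξ)
    (hobs : ∀ ξ, (∀ k < N, C ((L ^ k) ξ) = 0) → L ξ = 0)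
    {δ : ℝ} (hδ : 0 < δ) (ξ : E)
    (h0 : inner ℝ ξ (M ξ) - inner ℝ (auxFlow L δ ξ) (M (auxFlow L δ ξ)) = 0) :
    L ξ = 0 ∧ L (auxFlow L δ ξ) = 0 := by
  have hanti := auxV_anti L M w hw0 hw ξ
  have hconst : ∀ u ∈ Ioo 0 δ, inner ℝ (auxFlow L u ξ) (M (auxFlow L u ξ)) = inner ℝ ξ (M ξ) := by
    intro u hu
    have h1 := hanti hu.1.le
    have h2 := hanti hu.2.le
    simp only [auxFlow_zero] at h1 h2
    linarith
  have hk : ∀ k : ℕ, ∀ u ∈ Ioo 0 δ, C ((L ^ k) (auxFlow L u ξ)) = 0 := by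
    intro k
    induction k with
    | zero =>
      intro u hu
      simp only [pow_zero, one_apply_eq_self]
      apply hwC
      have hd := auxV_deriv L M ξ u
      have hd' : HasDerivAt (fun u => inner ℝ (auxFlow L u ξ) (M (auxFlow L u ξ))) 0 u := by
        apply (hasDerivAt_const u (inner ℝ ξ (M ξ))).congr_of_eventuallyEq
        filter_upwards [isOpen_Ioo.mem_nhds hu] with v hv using hconst v hv
      have := hd.unique hd'
      have h1 := hw (auxFlow L u ξ)
      have h2 := hw0 (auxFlow L u ξ)
      linarith
    | succ k ih =>
      intro u hu
      have hd : HasDerivAt (fun u => C ((L ^ k) (auxFlow L u ξ)))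
          (C ((L ^ k) (L (auxFlow L u ξ)))) u :=
        (C.comp (L ^ k)).hasFDerivAt.comp_hasDerivAt u (auxFlow_deriv L ξ u)
      have hd' : HasDerivAt (fun u => C ((L ^ k) (auxFlow L u ξ))) 0 u := by
        apply (hasDerivAt_const u (0 : F)).congr_of_eventuallyEq
        filter_upwards [isOpen_Ioo.mem_nhds hu] with v hv using ih v hv
      have := hd.unique hd'
      rw [pow_succ]
      exact this
  have hL : ∀ u ∈ Ioo 0 δ, L (auxFlow L u ξ) = 0 := fun u hu =>
    hobs _ (fun k _ => hk k u hu)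
  have hcont : Continuous (fun u => L (auxFlow L u ξ)) :=
    L.continuous.comp (continuous_iff_continuousAt.2 fun u => (auxFlow_deriv L ξ u).continuousAt)
  have hcl : closure (Ioo 0 δ) ⊆ {u | L (auxFlow L u ξ) = 0} :=
    closure_minimal hL (isClosed_eq hcont continuous_const)
  rw [closure_Ioo hδ.ne] at hcl
  refine ⟨?_, hcl (right_mem_Icc.2 hδ.le)⟩
  have := hcl (left_mem_Icc.2 hδ.le)
  simpa [auxFlow_zero] using this

end Obs

/-- Around every time, a dwell-time signal is constant on a forward or a backward interval. -/
lemma aux_dwell {Γ : Type*} [MetricSpace Γ] [Finite Γ] {σ : ℝ → Γ} {τ : ℝ} (hτ : 0 < τ)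
    (hσ : σ ∈ SD Γ τ) (t : ℝ) :
    (∀ s ∈ Icc t (t + τ / 8), σ s = σ t) ∨ (∀ s ∈ Icc (t - τ / 8) t, σ s = σ t) := by
  obtain ⟨hs, hcard⟩ := hσ
  by_cases hA : JumpTimes σ ∩ Ioo t (t + τ / 4) = ∅
  · left
    have hcst : ∀ a ∈ Ioo t (t + τ / 4), ∀ b ∈ Ioo t (t + τ / 4), σ a = σ b := by
      intro a ha b hb
      refine isPreconnected_Ioo.constant (fun s hs => ?_) ha hb
      by_contra hcon
      have : s ∈ JumpTimes σ ∩ Ioo t (t + τ / 4) :=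
        ⟨fun h => hcon h.continuousWithinAt, hs⟩
      rw [hA] at this
      exact this
    obtain ⟨ε, hε, hr⟩ := hs.rightConst t
    intro s hs
    rcases hs.1.eq_or_lt with h | h
    · rw [h]
    · set r := t + min (ε / 2) (τ / 8) with hrdef
      have h1 : 0 < min (ε / 2) (τ / 8) := by positivity
      have h2 := min_le_left (ε / 2) (τ / 8)
      have h3 := min_le_right (ε / 2) (τ / 8)
      rw [hcst s ⟨h, by linarith [hs.2]⟩ r ⟨by linarith, by linarith⟩]
      exact hr r ⟨by linarith, by linarith⟩
  · right
    obtain ⟨j, hj, hjI⟩ := nonempty_iff_ne_empty.2 hA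
    intro s hs'
    refine isPreconnected_Ioc.constant (s := Ioc (t - τ / 4) t) (fun r hr => ?_)
      ⟨by linarith [hs'.1], hs'.2⟩ ⟨by linarith, le_rfl⟩
    by_contra hcon
    have hrJ : r ∈ JumpTimes σ := fun h => hcon h.continuousWithinAt
    have hfin : (JumpTimes σ ∩ Ioo (t - τ / 4) (t + τ / 4)).Finite :=
      (hs.locFinite (t - τ / 4) (t + τ / 4)).subset
        (inter_subset_inter_right _ Ioo_subset_Icc_self)
    have hsub : ({r, j} : Set ℝ) ⊆ JumpTimes σ ∩ Ioo (t - τ / 4) (t + τ / 4) := by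
      rintro q (rfl | rfl)
      · exact ⟨hrJ, hr.1, by linarith [hr.2]⟩
      · exact ⟨hj, by linarith [hjI.1], hjI.2⟩
    have h2 := Set.ncard_le_ncard hsub hfin
    rw [Set.ncard_pair (by have := hr.2; have := hjI.1; intro h; linarith)] at h2
    have h3 := hcard (t - τ / 4) (t + τ / 4) (by linarith)
    have h4 : (t + τ / 4 - (t - τ / 4)) / τ = 1 / 2 := by field_simp; ring
    rw [h4] at h3
    have h5 : (2 : ℝ) ≤ ((JumpTimes σ ∩ Ioo (t - τ / 4) (t + τ / 4)).ncard : ℝ) := by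
      exact_mod_cast h2
    norm_num at h3
    linarith

lemma aux_main [FiniteDimensional ℝ E] {Γ : Type*} [MetricSpace Γ] [Finite Γ]
    (L M : Γ → E →L[ℝ] E)
    (hG0 : ∀ γ, ∀ δ > 0, ∀ ξ,
      0 ≤ inner ℝ ξ (M γ ξ) - inner ℝ (auxFlow (L γ) δ ξ) (M γ (auxFlow (L γ) δ ξ)))
    (hobs : ∀ γ, ∀ δ > 0, ∀ ξ,
      inner ℝ ξ (M γ ξ) - inner ℝ (auxFlow (L γ) δ ξ) (M γ (auxFlow (L γ) δ ξ)) = 0 →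
      L γ ξ = 0 ∧ L γ (auxFlow (L γ) δ ξ) = 0)
    (hker : ∀ ξ, (∀ γ, L γ ξ = 0) → ξ = 0)
    (x : ℝ → E) (σ : ℝ → Γ) {τ T R : ℝ} (hτ : 0 < τ) (hT : 0 < T)
    (hσ : σ ∈ SD Γ τ) (hσe : σ ∈ SE Γ T)
    (hc : ContinuousOn x (Ici 0))
    (hx : ∀ a, 0 ≤ a → ∀ b, 0 ≤ b → x b = x a + ∫ s in a..b, L (σ s) (x s))
    (hR : ∀ t, 0 ≤ t → ‖x t‖ ≤ R)
    (hV0 : ∀ t, 0 ≤ t → 0 ≤ inner ℝ (x t) (M (σ t) (x t)))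
    (hV : AntitoneOn (fun t => inner ℝ (x t) (M (σ t) (x t))) (Ici 0)) :
    Tendsto x atTop (𝓝 0) := by
  set V : ℝ → ℝ := fun t => inner ℝ (x t) (M (σ t) (x t)) with hVdef
  have hRK : ∀ t, 0 ≤ t → x t ∈ Metric.closedBall (0 : E) R := fun t ht => by
    simpa using hR t ht
  have hK : IsCompact (Metric.closedBall (0 : E) R) := isCompact_closedBall _ _
  set δ := τ / 8 with hδ
  have hδ0 : 0 < δ := by positivity
  -- the Lyapunov function is eventually almost constant
  have hdrop : ∀ η > 0, ∃ T0, 0 ≤ T0 ∧ ∀ s, T0 ≤ s → ∀ t, s ≤ t → V s - V t < η := by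
    intro η hη
    have hne : (V '' Ici 0).Nonempty := ⟨V 0, 0, le_refl (0 : ℝ), rfl⟩
    have hbdd : BddBelow (V '' Ici 0) := ⟨0, by rintro _ ⟨t, ht, rfl⟩; exact hV0 t ht⟩
    obtain ⟨_, ⟨T0, hT0, rfl⟩, hlt⟩ := exists_lt_of_csInf_lt hne
      (show sInf (V '' Ici 0) < sInf (V '' Ici 0) + η by linarith)
    refine ⟨T0, hT0, fun s hs t hst => ?_⟩
    have hs0 : (0 : ℝ) ≤ s := le_trans hT0 hs
    have h1 : V s ≤ V T0 := hV hT0 hs0 hs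
    have h2 : sInf (V '' Ici 0) ≤ V t := csInf_le hbdd ⟨t, hs0.trans hst, rfl⟩
    linarith
  -- solutions on intervals of constancy
  have hflow : ∀ γ a b, 0 ≤ a → a ≤ b → (∀ s ∈ Icc a b, σ s = γ) →
      x b = auxFlow (L γ) (b - a) (x a) := by
    intro γ a b ha hab hs
    refine aux_unique (L γ) hab (hc.mono fun t ht => ha.trans ht.1) ?_
    intro t ht
    rw [hx a ha t (ha.trans ht.1)]
    congr 1
    apply intervalIntegral.integral_congr
    intro s hs'
    rw [uIcc_of_le ht.1] at hs'
    simp only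
    rw [hs s ⟨hs'.1, hs'.2.trans ht.2⟩]
  -- the velocity tends to zero
  have hvel : ∀ ε > 0, ∃ T1, 0 ≤ T1 ∧ ∀ t, T1 ≤ t → ‖L (σ t) (x t)‖ < ε := by
    intro ε hε
    have hex : ∀ γ, ∃ η > 0, ∀ ξ ∈ Metric.closedBall (0 : E) R,
        inner ℝ ξ (M γ ξ) - inner ℝ (auxFlow (L γ) δ ξ) (M γ (auxFlow (L γ) δ ξ)) < η →
        ‖L γ ξ‖ + ‖L γ (auxFlow (L γ) δ ξ)‖ < ε := by
      intro γ
      have hf := auxFlow_cont (L γ) δ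
      refine aux_compact hK (by fun_prop) (by fun_prop) (hG0 γ δ hδ0) ?_ hε
      intro ξ hξ
      obtain ⟨h1, h2⟩ := hobs γ δ hδ0 ξ hξ
      simp [h1, h2]
    choose η hη hηp using hex
    obtain ⟨d, hd, hdη⟩ := aux_min η hη
    obtain ⟨T0, hT0, hT0p⟩ := hdrop d hd
    refine ⟨T0 + δ, by positivity, fun t ht => ?_⟩
    have ht0 : 0 ≤ t := by linarith
    rcases aux_dwell hτ hσ t with h | h
    · have hxe := hflow (σ t) t (t + δ) ht0 (by linarith) h
      have hse : σ (t + δ) = σ t := h (t + δ) ⟨by linarith, le_rfl⟩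
      have hdr := (hT0p t (by linarith) (t + δ) (by linarith)).trans_le (hdη (σ t))
      simp only [hVdef] at hdr
      rw [hse, hxe, add_sub_cancel_left] at hdr
      have := hηp (σ t) (x t) (hRK t ht0) hdr
      have := norm_nonneg (L (σ t) (auxFlow (L (σ t)) δ (x t)))
      linarith
    · have hxe := hflow (σ t) (t - δ) t (by linarith) (by linarith) h
      have hse : σ (t - δ) = σ t := h (t - δ) ⟨le_rfl, by linarith⟩
      have hdr := (hT0p (t - δ) (by linarith) t (by linarith)).trans_le (hdη (σ t))
      simp only [hVdef] at hdr
      rw [sub_sub_cancel] at hxe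
      rw [hse, hxe] at hdr
      have := hηp (σ t) (x (t - δ)) (hRK _ (by linarith)) hdr
      rw [← hxe] at this
      have := norm_nonneg (L (σ t) (x (t - δ)))
      linarith
  -- all the `L γ (x t)` tend to zero
  have hall : ∀ γ, Tendsto (fun t => ‖L γ (x t)‖) atTop (𝓝 0) := by
    intro γ
    rw [Metric.tendsto_atTop]
    intro ε hε
    set κ := 1 + ‖L γ‖ * T with hκ
    have hκ0 : 0 < κ := by positivity
    obtain ⟨T1, hT1, hT1p⟩ := hvel (ε / κ) (by positivity)
    refine ⟨T1, fun t ht => ?_⟩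
    have ht0 : 0 ≤ t := hT1.trans ht
    obtain ⟨t', ht', hσt'⟩ := hσe t ht0 γ
    have hdiff : ‖x t' - x t‖ ≤ ε / κ * T := by
      rw [hx t ht0 t' (ht0.trans ht'.1), add_sub_cancel_left]
      refine (intervalIntegral.norm_integral_le_of_norm_le_const (C := ε / κ) ?_).trans ?_
      · intro s hs
        rw [uIoc_of_le ht'.1] at hs
        exact (hT1p s (ht.trans hs.1.le)).le
      · rw [abs_of_nonneg (by linarith [ht'.1])]
        have : t' - t ≤ T := by linarith [ht'.2]
        gcongr
    have h1 := hT1p t' (ht.trans ht'.1)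
    rw [hσt'] at h1
    have h2 : L γ (x t) = L γ (x t') - L γ (x t' - x t) := by
      rw [map_sub]; abel
    have h3 : ‖L γ (x t' - x t)‖ ≤ ‖L γ‖ * (ε / κ * T) :=
      ((L γ).le_opNorm _).trans (by gcongr)
    have h4 : ‖L γ (x t)‖ ≤ ‖L γ (x t')‖ + ‖L γ (x t' - x t)‖ := by
      rw [h2]; exact norm_sub_le _ _
    have h5 : ε / κ + ‖L γ‖ * (ε / κ * T) = ε := by
      have : ε / κ + ‖L γ‖ * (ε / κ * T) = ε / κ * κ := by rw [hκ]; ring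
      rw [this]; field_simp
    rw [Real.dist_eq, sub_zero, abs_of_nonneg (norm_nonneg _)]
    linarith
  have := Fintype.ofFinite Γ
  have hsum : Tendsto (fun t => ∑ γ, ‖L γ (x t)‖) atTop (𝓝 0) := by
    have := tendsto_finsetSum (Finset.univ : Finset Γ) (fun γ _ => hall γ)
    simpa using this
  rw [tendsto_zero_iff_norm_tendsto_zero, Metric.tendsto_atTop]
  intro ε hε
  obtain ⟨η, hη, hηp⟩ := aux_compact (G := fun ξ => ∑ γ, ‖L γ ξ‖) (H := fun ξ => ‖ξ‖) hK
    (by fun_prop) (by fun_prop) (fun ξ => Finset.sum_nonneg fun _ _ => norm_nonneg _)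
    (by
      intro ξ hξ
      rw [Finset.sum_eq_zero_iff_of_nonneg (fun _ _ => norm_nonneg _)] at hξ
      rw [hker ξ (fun γ => norm_eq_zero.1 (hξ γ (Finset.mem_univ _))), norm_zero]) hε
  obtain ⟨N, hN⟩ := eventually_atTop.1 ((hsum.eventually (gt_mem_nhds hη)).and (eventually_ge_atTop 0))
  refine ⟨N, fun t ht => ?_⟩
  obtain ⟨h1, h2⟩ := hN t ht
  rw [Real.dist_eq, sub_zero, abs_of_nonneg (norm_nonneg _)]
  exact hηp _ (hRK t h2) h1

lemma aux_posdef [FiniteDimensional ℝ E] (M : E →L[ℝ] E)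
    (hM : ∀ ξ, ξ ≠ 0 → 0 < inner ℝ ξ (M ξ)) :
    ∃ c > 0, ∀ ξ, c * ‖ξ‖ ^ 2 ≤ inner ℝ ξ (M ξ) := by
  have hcont : Continuous (fun ξ : E => (inner ℝ ξ (M ξ) : ℝ)) := by fun_prop
  obtain ⟨c, hc, h⟩ := (isCompact_sphere (0 : E) 1).exists_forall_le' hcont.continuousOn (a := 0)
    (by
      intro ξ hξ
      apply hM
      rintro rfl
      simp at hξ)
  refine ⟨c, hc, fun ξ => ?_⟩
  by_cases h0 : ξ = 0
  · simp [h0]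
  have hn : 0 < ‖ξ‖ := norm_pos_iff.2 h0
  have := h (‖ξ‖⁻¹ • ξ) (by simp [norm_smul, hn.ne'])
  rw [map_smul, inner_smul_left, inner_smul_right] at this
  simp only [conj_trivial] at this
  calc c * ‖ξ‖ ^ 2 ≤ (‖ξ‖⁻¹ * (‖ξ‖⁻¹ * inner ℝ ξ (M ξ))) * ‖ξ‖ ^ 2 := by gcongr
    _ = inner ℝ ξ (M ξ) := by field_simp

end Aux

noncomputable section
open Matrix

theorem linear_switched_GAS
    {n : ℕ} {Γ : Type*} [MetricSpace Γ] [Finite Γ]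
    (A : Γ → Matrix (Fin n) (Fin n) ℝ)
    (T : Set ((ℝ → Eucl n) × (ℝ → Γ)))
    (hT : ∀ xs ∈ T, ∃ I : Set ℝ, Set.Ici (0 : ℝ) ⊆ I ∧
      IsTrajectory
        (fun p : Eucl n × Γ => (EuclideanSpace.equiv (Fin n) ℝ).symm
          ((A p.2).mulVec (EuclideanSpace.equiv (Fin n) ℝ p.1)))
        Set.univ xs.1 xs.2 I)
    (hTσ : ∀ xs ∈ T, xs.2 ∈ SDall Γ ∩ SEall Γ)
    (P : Γ → Matrix (Fin n) (Fin n) ℝ) (hP : ∀ γ : Γ, (P γ).PosDef)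
    (m : Γ → ℕ) (C : (γ : Γ) → Matrix (Fin (m γ)) (Fin n) ℝ)
    (h1 : ∀ γ : Γ, ∀ ξ : Fin n → ℝ,
      ξ ⬝ᵥ (P γ * A γ + (A γ)ᵀ * P γ).mulVec ξ ≤
        -((C γ).mulVec ξ ⬝ᵥ (C γ).mulVec ξ))
    (h2 : ∀ xs ∈ T, AntitoneOn
      (fun t => EuclideanSpace.equiv (Fin n) ℝ (xs.1 t) ⬝ᵥ
        (P (xs.2 t)).mulVec (EuclideanSpace.equiv (Fin n) ℝ (xs.1 t)))
      (Set.Ici 0))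
    (h3 : ∀ γ : Γ,
      {ξ : Fin n → ℝ | ∀ k < n, (C γ).mulVec ((A γ ^ k).mulVec ξ) = 0} =
      {ξ : Fin n → ℝ | (A γ).mulVec ξ = 0})
    (h4 : {ξ : Fin n → ℝ | ∀ γ : Γ, (A γ).mulVec ξ = 0} = {0}) :
    FamilyGAS T := by
  classical
  set Lm : Γ → Eucl n →L[ℝ] Eucl n := fun γ => (Matrix.toEuclideanLin (A γ)).toContinuousLinearMap
    with hLm
  set M : Γ → Eucl n →L[ℝ] Eucl n := fun γ => (Matrix.toEuclideanLin (P γ)).toContinuousLinearMap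
    with hMdef
  set Cm : (γ : Γ) → Eucl n →L[ℝ] Eucl (m γ) :=
    fun γ => (Matrix.toEuclideanLin (C γ)).toContinuousLinearMap with hCm
  have hLval : ∀ γ (ξ : Eucl n), (Lm γ ξ).ofLp = (A γ) *ᵥ ξ.ofLp := fun γ ξ => rfl
  have hMval : ∀ γ (ξ : Eucl n), (M γ ξ).ofLp = (P γ) *ᵥ ξ.ofLp := fun γ ξ => rfl
  have hCval : ∀ γ (ξ : Eucl n), (Cm γ ξ).ofLp = (C γ) *ᵥ ξ.ofLp := fun γ ξ => rfl
  have hin : ∀ (ξ η : Eucl n), inner ℝ ξ η = ξ.ofLp ⬝ᵥ η.ofLp := by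
    intro ξ η
    rw [EuclideanSpace.inner_eq_star_dotProduct, star_trivial, dotProduct_comm]
  have hLpow : ∀ γ (k : ℕ) (ξ : Eucl n), ((Lm γ ^ k) ξ).ofLp = (A γ ^ k) *ᵥ ξ.ofLp := by
    intro γ k
    induction k with
    | zero => intro ξ; simp
    | succ k ih =>
      intro ξ
      rw [pow_succ, pow_succ, ← Matrix.mulVec_mulVec, ← hLval, ← ih]
      rfl
  have hMpos : ∀ γ (ξ : Eucl n), ξ ≠ 0 → 0 < inner ℝ ξ (M γ ξ) := by
    intro γ ξ hξ
    rw [hin, hMval]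
    have := (hP γ).dotProduct_mulVec_pos (x := ξ.ofLp) (by simpa using hξ)
    simpa using this
  have hV0 : ∀ γ (ξ : Eucl n), 0 ≤ inner ℝ ξ (M γ ξ) := by
    intro γ ξ
    by_cases h : ξ = 0
    · simp [h]
    · exact (hMpos γ ξ h).le
  have hdiss : ∀ γ (ξ : Eucl n), inner ℝ ξ (M γ (Lm γ ξ)) + inner ℝ (Lm γ ξ) (M γ ξ) ≤
      - ‖Cm γ ξ‖ ^ 2 := by
    intro γ ξ
    have h := h1 γ ξ.ofLp
    rw [hin, hin, hMval, hMval, hLval, ← real_inner_self_eq_norm_sq,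
      EuclideanSpace.inner_eq_star_dotProduct, star_trivial, hCval]
    refine le_trans (le_of_eq ?_) h
    rw [Matrix.add_mulVec, dotProduct_add, ← Matrix.mulVec_mulVec, ← Matrix.mulVec_mulVec]
    congr 1
    rw [Matrix.dotProduct_mulVec ξ.ofLp, Matrix.vecMul_transpose]
  have hobs : ∀ γ, ∀ δ > 0, ∀ ξ : Eucl n,
      inner ℝ ξ (M γ ξ) - inner ℝ (auxFlow (Lm γ) δ ξ) (M γ (auxFlow (Lm γ) δ ξ)) = 0 →
      Lm γ ξ = 0 ∧ Lm γ (auxFlow (Lm γ) δ ξ) = 0 := by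
    intro γ δ hδ ξ h0
    refine aux_obs (Lm γ) (M γ) (Cm γ) (fun ξ => ‖Cm γ ξ‖ ^ 2) n (fun ξ => by positivity)
      (fun ξ h => by simpa using h) (hdiss γ) ?_ hδ ξ h0
    intro ξ hk
    have hmem : ξ.ofLp ∈ {ξ : Fin n → ℝ | ∀ k < n, (C γ).mulVec ((A γ ^ k).mulVec ξ) = 0} := by
      intro k hkn
      rw [← hLpow, ← hCval, hk k hkn]
      rfl
    rw [h3 γ] at hmem
    have hm : (A γ) *ᵥ ξ.ofLp = 0 := hmem
    rw [← hLval] at hm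
    exact (WithLp.ofLp_eq_zero 2).1 hm
  have hG0 : ∀ γ, ∀ δ > 0, ∀ ξ : Eucl n,
      0 ≤ inner ℝ ξ (M γ ξ) - inner ℝ (auxFlow (Lm γ) δ ξ) (M γ (auxFlow (Lm γ) δ ξ)) := by
    intro γ δ hδ ξ
    have := auxV_anti (Lm γ) (M γ) (fun ξ => ‖Cm γ ξ‖ ^ 2) (fun ξ => by positivity) (hdiss γ) ξ
      (le_of_lt hδ)
    simp only [auxFlow_zero] at this
    linarith
  have hker : ∀ ξ : Eucl n, (∀ γ, Lm γ ξ = 0) → ξ = 0 := by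
    intro ξ h
    have hmem : ξ.ofLp ∈ {ξ : Fin n → ℝ | ∀ γ : Γ, (A γ).mulVec ξ = 0} := by
      intro γ
      rw [← hLval, h γ]
      rfl
    rw [h4] at hmem
    exact (WithLp.ofLp_eq_zero 2).1 hmem
  have hVanti : ∀ xs ∈ T, AntitoneOn (fun t => inner ℝ (xs.1 t) (M (xs.2 t) (xs.1 t)))
      (Set.Ici (0 : ℝ)) := by
    intro xs hxs
    have h := h2 xs hxs
    refine h.congr ?_
    intro t _
    simp only [hin, hMval]
    rfl
  choose c hc hcle using fun γ => aux_posdef (M γ) (hMpos γ)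
  obtain ⟨d, hd, hdc⟩ := aux_min c hc
  obtain ⟨B, hB⟩ : ∃ B : ℝ, ∀ γ, ‖M γ‖ ≤ B := by
    obtain ⟨B, hB⟩ := (Set.finite_range fun γ => ‖M γ‖).bddAbove
    exact ⟨B, fun γ => hB ⟨γ, rfl⟩⟩
  set κ : ℝ := 1 + |B| / d with hκ
  have hκ1 : 1 ≤ κ := by
    have : 0 ≤ |B| / d := by positivity
    linarith
  have hbound : ∀ xs ∈ T, ∀ t₀ : ℝ, 0 ≤ t₀ → ∀ t : ℝ, t₀ ≤ t → ‖xs.1 t‖ ≤ κ * ‖xs.1 t₀‖ := by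
    intro xs hxs t₀ ht₀ t ht
    have ha : inner ℝ (xs.1 t) (M (xs.2 t) (xs.1 t)) ≤ inner ℝ (xs.1 t₀) (M (xs.2 t₀) (xs.1 t₀)) :=
      hVanti xs hxs ht₀ (ht₀.trans ht) ht
    have hb : d * ‖xs.1 t‖ ^ 2 ≤ inner ℝ (xs.1 t) (M (xs.2 t) (xs.1 t)) :=
      le_trans (by gcongr; exact hdc _) (hcle (xs.2 t) (xs.1 t))
    have he : inner ℝ (xs.1 t₀) (M (xs.2 t₀) (xs.1 t₀)) ≤ |B| * ‖xs.1 t₀‖ ^ 2 := by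
      calc inner ℝ (xs.1 t₀) (M (xs.2 t₀) (xs.1 t₀))
          ≤ ‖xs.1 t₀‖ * ‖M (xs.2 t₀) (xs.1 t₀)‖ := real_inner_le_norm _ _
        _ ≤ ‖xs.1 t₀‖ * (|B| * ‖xs.1 t₀‖) := by
          gcongr
          exact ((M (xs.2 t₀)).le_opNorm _).trans
            (by gcongr; exact (hB _).trans (le_abs_self B))
        _ = |B| * ‖xs.1 t₀‖ ^ 2 := by ring
    have hf : ‖xs.1 t‖ ^ 2 ≤ (|B| / d) * ‖xs.1 t₀‖ ^ 2 := by
      rw [div_mul_eq_mul_div, le_div_iff₀ hd]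
      linarith
    have hg : (|B| / d) ≤ κ ^ 2 := by nlinarith
    refine le_of_sq_le_sq ?_ (by positivity)
    rw [mul_pow]
    exact hf.trans (by gcongr)
  refine ⟨⟨fun r => κ * r, ⟨⟨by fun_prop, ?_, by simp⟩, ?_⟩, hbound⟩, ?_⟩
  · intro a _ b _ hab
    exact mul_lt_mul_of_pos_left hab (by linarith)
  · exact Filter.tendsto_id.const_mul_atTop (by linarith)
  · intro xs hxs
    obtain ⟨I, hI, htr⟩ := hT xs hxs
    obtain ⟨hd1, he1⟩ := hTσ xs hxs
    simp only [SDall, SEall, Set.mem_iUnion, Set.mem_Ioi] at hd1 he1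
    obtain ⟨τ, hτ, hσ⟩ := hd1
    obtain ⟨T₀, hT₀, hσe⟩ := he1
    exact aux_main Lm M hG0 hobs hker xs.1 xs.2 (R := κ * ‖xs.1 0‖) hτ hT₀ hσ hσe
      (htr.cont.mono hI) (fun a ha b hb => (htr.intg a (hI ha) b (hI hb)).2)
      (fun t ht => hbound xs hxs 0 le_rfl t ht) (fun t _ => hV0 _ _) (hVanti xs hxs)
end
end

section
/- Let τ_D > 0, N₀ ∈ ℕ, and let {σ_k} be a sequence of switching signals in S_a[τ_D,N₀]. Then there exist a subsequence {σ_{k_l}} and a switching signal σ* ∈ S_a[τ_D,N₀] such that: (1) σ_{k_l}(t) → σ*(t) as l → ∞ for almost all t ∈ ℝ; (2) for each t ∈ ℝ there is a sequence of times {r_l(t)} with r_l(t) → t, σ_{k_l}(r_l(t)) → σ*(t), and lim_{l→∞} (τ¹_{σ_{k_l}}(r_l(t)) − r_l(t)) exists and is strictly positive (possibly +∞). -/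
open Filter Topology MeasureTheory Set

noncomputable section

/-- No jumps on `(x, y]` implies that a switching signal is constant on `[x, y]`. -/
lemma sw_const {Γ : Type*} [MetricSpace Γ] {σ : ℝ → Γ} (h : IsSwitchingSignal σ) {x y : ℝ}
    (hxy : x ≤ y) (hJ : ∀ z ∈ Ioc x y, z ∉ JumpTimes σ) : σ y = σ x := by
  have hc : ContinuousOn σ (Icc x y) := by
    intro z hz
    rcases eq_or_lt_of_le hz.1 with rfl | hlt
    · obtain ⟨ε, hε, he⟩ := h.rightConst x
      have h1 : ContinuousWithinAt (fun _ => σ x) (Icc x y) x := continuousWithinAt_const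
      refine h1.congr_of_eventuallyEq ?_ rfl
      have h2 : Iio (x + ε) ∈ 𝓝[Icc x y] x := mem_nhdsWithin_of_mem_nhds (Iio_mem_nhds (by linarith))
      filter_upwards [h2, self_mem_nhdsWithin] with w hw hw2
      exact he w ⟨hw2.1, hw⟩
    · have := hJ z ⟨hlt, hz.2⟩
      simp only [JumpTimes, mem_setOf_eq, not_not] at this
      exact this.continuousWithinAt
  have hsub : Icc x y ⊆ {z | σ z = σ x} := by
    apply IsClosed.Icc_subset_of_forall_mem_nhdsWithin
    · have := hc.preimage_isClosed_of_isClosed isClosed_Icc (isClosed_singleton (x := σ x))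
      rwa [inter_comm] at this
    · rfl
    · intro z hz
      obtain ⟨ε, hε, he⟩ := h.rightConst z
      have h2 : Iio (z + ε) ∈ 𝓝[>] z := mem_nhdsWithin_of_mem_nhds (Iio_mem_nhds (by linarith))
      filter_upwards [h2, self_mem_nhdsWithin] with w hw hw2
      have := he w ⟨le_of_lt hw2, hw⟩
      have h3 : σ z = σ x := hz.1
      simp [this, h3]
  exact hsub ⟨hxy, le_rfl⟩

/-- Points around which, eventually, there are no jumps. -/
def GoodPts {Γ : Type*} [TopologicalSpace Γ] (s : ℕ → ℝ → Γ) : Set ℝ :=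
  {t | ∃ ε > (0:ℝ), ∀ᶠ k in atTop, ∀ x ∈ Ioo (t - ε) (t + ε), x ∉ JumpTimes (s k)}

lemma good_compact {Γ : Type*} [TopologicalSpace Γ] (s : ℕ → ℝ → Γ) {K : Set ℝ}
    (hK : IsCompact K) (hKG : K ⊆ GoodPts s) :
    ∀ᶠ k in atTop, ∀ x ∈ K, x ∉ JumpTimes (s k) := by
  refine hK.induction_on (p := fun u => ∀ᶠ k in atTop, ∀ x ∈ u, x ∉ JumpTimes (s k)) ?_ ?_ ?_ ?_
  · simp
  · intro u v huv hv
    filter_upwards [hv] with k hk x hx using hk x (huv hx)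
  · intro u v hu hv
    filter_upwards [hu, hv] with k h1 h2 x hx
    exact hx.elim (h1 x) (h2 x)
  · intro x hx
    obtain ⟨ε, hε, he⟩ := hKG hx
    exact ⟨_, mem_nhdsWithin_of_mem_nhds (Ioo_mem_nhds (by linarith) (by linarith)), he⟩

lemma tau1_lt {Γ : Type*} [TopologicalSpace Γ] {σ : ℝ → Γ} {q b : ℝ}
    (h : tau1 σ q < (b : EReal)) : ∃ x ∈ JumpTimes σ, q < x ∧ x < b := by
  obtain ⟨_, ⟨x, hx, rfl⟩, hxb⟩ := sInf_lt_iff.1 h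
  exact ⟨x, hx.1, hx.2, by exact_mod_cast hxb⟩

lemma tau1_le {Γ : Type*} [TopologicalSpace Γ] {σ : ℝ → Γ} {q x : ℝ}
    (hx : x ∈ JumpTimes σ) (hq : q < x) : tau1 σ q ≤ (x : EReal) :=
  sInf_le ⟨x, ⟨hx, hq⟩, rfl⟩

lemma bad_eventually {Γ : Type*} [TopologicalSpace Γ] (s : ℕ → ℝ → Γ)
    (hT : ∀ q : ℚ, ∃ T : EReal, Tendsto (fun k => tau1 (s k) q) atTop (𝓝 T))
    {t : ℝ} (ht : t ∉ GoodPts s) {ε : ℝ} (hε : 0 < ε) :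
    ∀ᶠ k in atTop, ∃ x ∈ JumpTimes (s k), t - ε < x ∧ x < t + ε := by
  obtain ⟨q, hq1, hq2⟩ := exists_rat_btwn (show t - ε < t - ε / 2 by linarith)
  obtain ⟨T, hT⟩ := hT q
  have hf : ∃ᶠ k in atTop, tau1 (s k) q ≤ ((t + ε / 2 : ℝ) : EReal) := by
    intro hev
    apply ht
    refine ⟨ε / 2, by linarith, ?_⟩
    filter_upwards [hev] with k hk x hx hxJ
    apply hk
    refine (tau1_le hxJ (by linarith [hx.1])).trans ?_
    exact_mod_cast hx.2.le
  have hle : T ≤ ((t + ε / 2 : ℝ) : EReal) := by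
    by_contra hcon
    push Not at hcon
    have := hT.eventually (lt_mem_nhds hcon)
    obtain ⟨k, h1, h2⟩ := (hf.and_eventually this).exists
    exact absurd h2 (not_lt.2 h1)
  have hlt : T < ((t + ε : ℝ) : EReal) := lt_of_le_of_lt hle (by exact_mod_cast (by linarith))
  filter_upwards [hT.eventually (gt_mem_nhds hlt)] with k hk
  obtain ⟨x, hx, h1, h2⟩ := tau1_lt hk
  exact ⟨x, hx, by linarith, h2⟩

lemma bad_card {Γ : Type*} [TopologicalSpace Γ] (s : ℕ → ℝ → Γ)
    (hT : ∀ q : ℚ, ∃ T : EReal, Tendsto (fun k => tau1 (s k) q) atTop (𝓝 T))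
    (τD : ℝ) (N₀ : ℕ) (hs : ∀ k, s k ∈ SA Γ τD N₀) {a b : ℝ} (hab : a < b)
    (F : Finset ℝ) (hF : (F : Set ℝ) ⊆ (GoodPts s)ᶜ ∩ Ioo a b) :
    (F.card : ℝ) ≤ N₀ + (b - a) / τD := by
  have hδ : ∀ᶠ δ in 𝓝[>] (0:ℝ), 0 < δ ∧ (∀ x ∈ F, δ < x - a ∧ δ < b - x) ∧
      ∀ x ∈ F, ∀ y ∈ F, x ≠ y → 2 * δ < |x - y| := by
    have key : ∀ c : ℝ, 0 < c → ∀ᶠ δ in 𝓝[>] (0:ℝ), δ < c := fun c hc =>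
      mem_nhdsWithin_of_mem_nhds (Iio_mem_nhds hc)
    refine Eventually.and self_mem_nhdsWithin (Eventually.and ?_ ?_)
    · rw [Filter.eventually_all_finset]
      intro x hx
      have := (hF hx).2
      exact (key _ (by linarith [this.1])).and (key _ (by linarith [this.2]))
    · rw [Filter.eventually_all_finset]
      intro x hx
      rw [Filter.eventually_all_finset]
      intro y hy
      by_cases hxy : x = y
      · simp [hxy]
      · have h0 : 0 < |x - y| := abs_pos.2 (sub_ne_zero.2 hxy)
        filter_upwards [key (|x - y| / 2) (by linarith)] with δ hd _
        linarith
  obtain ⟨δ, hδ0, hδ1, hδ2⟩ := hδ.exists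
  have hev : ∀ᶠ k in atTop, ∀ t ∈ F, ∃ x ∈ JumpTimes (s k), t - δ < x ∧ x < t + δ := by
    rw [Filter.eventually_all_finset]
    intro t ht
    exact bad_eventually s hT (hF ht).1 hδ0
  obtain ⟨k, hk⟩ := hev.exists
  choose! f hf1 hf2 hf3 using hk
  refine le_trans ?_ ((hs k).2 a b hab)
  have hfin : (JumpTimes (s k) ∩ Ioo a b).Finite :=
    ((hs k).1.locFinite a b).subset (inter_subset_inter_right _ Ioo_subset_Icc_self)
  have := Set.ncard_le_ncard_of_injOn (s := (F : Set ℝ)) f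
    (fun x hx => (⟨hf1 x hx, by linarith [hf2 x hx, hδ1 x hx], by linarith [hf3 x hx, hδ1 x hx]⟩ :
      f x ∈ JumpTimes (s k) ∩ Ioo a b))
    (by
      intro x hx y hy hxy
      by_contra hne
      have h1 := hδ2 x hx y hy hne
      have := hf2 x hx; have := hf3 x hx; have := hf2 y hy; have := hf3 y hy
      have : |x - y| < 2 * δ := by
        rw [abs_lt]; constructor <;> linarith
      linarith) hfin
  rw [Set.ncard_coe_finset] at this
  exact_mod_cast this

lemma bad_finite {Γ : Type*} [TopologicalSpace Γ] (s : ℕ → ℝ → Γ)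
    (hT : ∀ q : ℚ, ∃ T : EReal, Tendsto (fun k => tau1 (s k) q) atTop (𝓝 T))
    (τD : ℝ) (N₀ : ℕ) (hs : ∀ k, s k ∈ SA Γ τD N₀) {a b : ℝ} (hab : a < b) :
    ((GoodPts s)ᶜ ∩ Ioo a b).Finite := by
  by_contra hinf
  obtain ⟨n, hn⟩ := exists_nat_gt ((N₀ : ℝ) + (b - a) / τD)
  obtain ⟨F, hF, hc⟩ := Set.Infinite.exists_subset_card_eq hinf n
  have := bad_card s hT τD N₀ hs hab F hF
  rw [hc] at this
  linarith

lemma main_aux {Γ : Type*} [MetricSpace Γ]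
    (s : ℕ → ℝ → Γ)
    (hT : ∀ q : ℚ, ∃ T : EReal, Tendsto (fun k => tau1 (s k) q) atTop (𝓝 T))
    (hg : ∀ q : ℚ, ∃ g : Γ, Tendsto (fun k => s k q) atTop (𝓝 g))
    (τD : ℝ) (N₀ : ℕ) (hs : ∀ k, s k ∈ SA Γ τD N₀) :
    ∃ σstar ∈ SA Γ τD N₀,
      (∀ᵐ t ∂(volume : Measure ℝ), Tendsto (fun l => s l t) atTop (𝓝 (σstar t))) ∧
      ∀ t : ℝ, ∃ r : ℕ → ℝ,
        Tendsto r atTop (𝓝 t) ∧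
        Tendsto (fun l => s l (r l)) atTop (𝓝 (σstar t)) ∧
        ∃ L : EReal, 0 < L ∧
          Tendsto (fun l => tau1 (s l) (r l) - Real.toEReal (r l)) atTop (𝓝 L) := by
  -- punctured neighbourhoods are good
  have hpunct : ∀ t : ℝ, ∃ ε > (0:ℝ), ∀ x ∈ Ioo (t - ε) (t + ε), x ≠ t → x ∈ GoodPts s := by
    intro t
    have hfin := (bad_finite s hT τD N₀ hs (show t - 1 < t + 1 by linarith)).subset
      (diff_subset (t := {t}))
    have hn : ((((GoodPts s)ᶜ ∩ Ioo (t - 1) (t + 1)) \ {t})ᶜ ∩ Ioo (t - 1) (t + 1)) ∈ 𝓝 t :=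
      inter_mem (hfin.isClosed.isOpen_compl.mem_nhds (by simp))
        (Ioo_mem_nhds (by linarith) (by linarith))
    obtain ⟨ε, hε, he⟩ := Metric.mem_nhds_iff.1 hn
    refine ⟨ε, hε, fun x hx hxt => ?_⟩
    rw [← Real.ball_eq_Ioo] at hx
    have := he hx
    by_contra hxG
    exact this.1 ⟨⟨hxG, this.2⟩, hxt⟩
  -- on a good interval, values eventually coincide
  have hcoin : ∀ a b : ℝ, Ioo a b ⊆ GoodPts s → ∀ x ∈ Ioo a b, ∀ y ∈ Ioo a b,
      ∀ᶠ k in atTop, s k x = s k y := by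
    intro a b hab
    have aux : ∀ x ∈ Ioo a b, ∀ y ∈ Ioo a b, x ≤ y → ∀ᶠ k in atTop, s k y = s k x := by
      intro x hx y hy hxy
      filter_upwards [good_compact s (isCompact_Icc (a := x) (b := y))
        (fun z hz => hab ⟨hx.1.trans_le hz.1, hz.2.trans_lt hy.2⟩)] with k hk
      exact sw_const (hs k).1 hxy (fun z hz => hk z (Ioc_subset_Icc_self hz))
    intro x hx y hy
    rcases le_total x y with h | h
    · filter_upwards [aux x hx y hy h] with k hk using hk.symm
    · exact aux y hy x hx h
  have hlim : ∀ a b : ℝ, a < b → Ioo a b ⊆ GoodPts s → ∃ c : Γ, ∀ x ∈ Ioo a b,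
      Tendsto (fun k => s k x) atTop (𝓝 c) := by
    intro a b hlt hab
    obtain ⟨q, hq1, hq2⟩ := exists_rat_btwn hlt
    obtain ⟨c, hc⟩ := hg q
    refine ⟨c, fun x hx => hc.congr' ?_⟩
    exact hcoin a b hab q ⟨hq1, hq2⟩ x hx
  -- definition of the limit signal
  have hdef : ∀ t : ℝ, ∃ c : Γ, ∃ ε > (0:ℝ), Ioo t (t + ε) ⊆ GoodPts s ∧
      ∀ x ∈ Ioo t (t + ε), Tendsto (fun k => s k x) atTop (𝓝 c) := by
    intro t
    obtain ⟨ε, hε, he⟩ := hpunct t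
    have hsub : Ioo t (t + ε) ⊆ GoodPts s := fun x hx =>
      he x ⟨by linarith [hx.1], hx.2⟩ hx.1.ne'
    obtain ⟨c, hc⟩ := hlim t (t + ε) (by linarith) hsub
    exact ⟨c, ε, hε, hsub, hc⟩
  choose σ δ hδ hδG hσ using hdef
  have hopen : ∀ t ∈ GoodPts s, ∃ ε > (0:ℝ), Ioo (t - ε) (t + ε) ⊆ GoodPts s := by
    intro t ht
    obtain ⟨ε, hε, he⟩ := hpunct t
    refine ⟨ε, hε, fun x hx => ?_⟩
    by_cases h : x = t
    · rwa [h]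
    · exact he x hx h
  have hGlim : ∀ t ∈ GoodPts s, Tendsto (fun k => s k t) atTop (𝓝 (σ t)) := by
    intro t ht
    obtain ⟨ε, hε, he⟩ := hopen t ht
    obtain ⟨c, hc⟩ := hlim _ _ (by linarith) he
    have hm : 0 < min ε (δ t) := lt_min hε (hδ t)
    have h1 := min_le_left ε (δ t)
    have h2 := min_le_right ε (δ t)
    have e1 := hc (t + min ε (δ t) / 2) ⟨by linarith, by linarith⟩
    have e2 := hσ t (t + min ε (δ t) / 2) ⟨by linarith, by linarith⟩
    rw [tendsto_nhds_unique e2 e1]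
    exact hc t ⟨by linarith, by linarith⟩
  have hconst : ∀ a b : ℝ, Ioo a b ⊆ GoodPts s → ∀ x ∈ Ioo a b, ∀ y ∈ Ioo a b, σ x = σ y := by
    intro a b hab x hx y hy
    obtain ⟨c, hc⟩ := hlim a b (hx.1.trans hx.2) hab
    rw [tendsto_nhds_unique (hGlim x (hab hx)) (hc x hx),
      tendsto_nhds_unique (hGlim y (hab hy)) (hc y hy)]
  have hJ : JumpTimes σ ⊆ (GoodPts s)ᶜ := by
    intro t ht hG
    apply ht
    obtain ⟨ε, hε, he⟩ := hopen t hG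
    have h1 : ContinuousAt (fun _ : ℝ => σ t) t := continuousAt_const
    refine h1.congr ?_
    filter_upwards [Ioo_mem_nhds (show t - ε < t by linarith) (show t < t + ε by linarith)] with x hx
    exact hconst _ _ he t ⟨by linarith, by linarith⟩ x hx
  refine ⟨σ, ⟨⟨?_, ?_, ?_⟩, ?_⟩, ?_, ?_⟩
  · intro a b
    rcases le_or_gt a b with hab | hab
    · exact (bad_finite s hT τD N₀ hs (show a - 1 < b + 1 by linarith)).subset
        (inter_subset_inter hJ (fun x hx => ⟨by linarith [hx.1], by linarith [hx.2]⟩))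
    · simp [Icc_eq_empty (not_le.2 hab)]
  · intro t
    refine ⟨δ t, hδ t, fun x hx => ?_⟩
    rcases eq_or_lt_of_le hx.1 with rfl | hlt
    · rfl
    · exact tendsto_nhds_unique (hGlim x (hδG t ⟨hlt, hx.2⟩)) (hσ t x ⟨hlt, hx.2⟩)
  · intro t
    obtain ⟨ε, hε, he⟩ := hpunct t
    refine ⟨ε, hε, hconst _ _ (fun x hx => he x ⟨hx.1, by linarith [hx.2]⟩ hx.2.ne)⟩
  · intro a b hab
    have hf := (bad_finite s hT τD N₀ hs hab).subset (inter_subset_inter_left _ hJ)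
    rw [Set.ncard_eq_toFinset_card _ hf]
    apply bad_card s hT τD N₀ hs hab
    rw [hf.coe_toFinset]
    exact inter_subset_inter_left _ hJ
  · have hcount : ((GoodPts s)ᶜ).Countable := by
      have : (GoodPts s)ᶜ ⊆ ⋃ n : ℕ, (GoodPts s)ᶜ ∩ Ioo (-(n + 1 : ℝ)) (n + 1) := by
        intro x hx
        obtain ⟨n, hn⟩ := exists_nat_gt |x|
        have := abs_lt.1 hn
        exact mem_iUnion.2 ⟨n, hx, by linarith, by linarith⟩
      refine (countable_iUnion fun n : ℕ => ?_).mono this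
      exact (bad_finite s hT τD N₀ hs (by have : (0:ℝ) ≤ n := n.cast_nonneg
                                          linarith)).countable
    have h0 : ∀ᵐ t ∂(volume : Measure ℝ), t ∉ (GoodPts s)ᶜ :=
      measure_eq_zero_iff_ae_notMem.1 (hcount.measure_zero volume)
    filter_upwards [h0] with t ht
    exact hGlim t (not_not.1 ht)
  · intro t
    obtain ⟨q, hq1, hq2⟩ := exists_rat_btwn (show t < t + δ t by linarith [hδ t])
    obtain ⟨T, hTq⟩ := hT q
    let S : ℕ → Set ℝ := fun l => insert t (JumpTimes (s l) ∩ Ico t q)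
    have hbdd : ∀ l, ∀ x ∈ S l, x ≤ q := by
      rintro l x (rfl | hx)
      · exact hq1.le
      · exact hx.2.2.le
    have hBA : ∀ l, BddAbove (S l) := fun l => ⟨q, hbdd l⟩
    have hne : ∀ l, (S l).Nonempty := fun l => ⟨t, mem_insert _ _⟩
    let r : ℕ → ℝ := fun l => sSup (S l)
    have hrt : ∀ l, t ≤ r l := fun l => le_csSup (hBA l) (mem_insert _ _)
    have hrq : ∀ l, r l ≤ q := fun l => csSup_le (hne l) (hbdd l)
    have hnoJ : ∀ l, ∀ x, r l < x → x < q → x ∉ JumpTimes (s l) := by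
      intro l x h1 h2 hx
      have : x ≤ r l := le_csSup (hBA l) (mem_insert_of_mem _ ⟨hx, (hrt l).trans h1.le, h2⟩)
      linarith
    have hr : Tendsto r atTop (𝓝 t) := by
      rw [tendsto_order]
      refine ⟨fun a ha => Eventually.of_forall fun l => ha.trans_le (hrt l), fun a ha => ?_⟩
      obtain ⟨a', h1, h2⟩ := exists_between ha
      filter_upwards [good_compact s (isCompact_Icc (a := a') (b := q)) (fun z hz =>
        hδG t ⟨h1.trans_le hz.1, hz.2.trans_lt hq2⟩)] with l hl
      refine lt_of_le_of_lt (csSup_le (hne l) ?_) h2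
      rintro x (rfl | hx)
      · exact h1.le
      · by_contra hcon
        exact hl x ⟨(not_le.1 hcon).le, hx.2.2.le⟩ hx.1
    have hqG : (q : ℝ) ∈ GoodPts s := hδG t ⟨hq1, hq2⟩
    have hnoJ' : ∀ᶠ l in atTop, ∀ x ∈ Ioc (r l) (q : ℝ), x ∉ JumpTimes (s l) := by
      filter_upwards [good_compact s (isCompact_singleton (x := (q : ℝ))) (by simpa using hqG)]
        with l hl x hx
      rcases eq_or_lt_of_le hx.2 with h | h
      · exact hl x h
      · exact hnoJ l x hx.1 h
    refine ⟨r, hr, ?_, ?_⟩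
    · refine (hσ t q ⟨hq1, hq2⟩).congr' ?_
      filter_upwards [hnoJ'] with l hl
      exact sw_const (hs l).1 (hrq l) hl
    · have htau : ∀ᶠ l in atTop, tau1 (s l) q = tau1 (s l) (r l) := by
        filter_upwards [hnoJ'] with l hl
        have : JumpTimes (s l) ∩ Ioi (q : ℝ) = JumpTimes (s l) ∩ Ioi (r l) := by
          ext x
          simp only [mem_inter_iff, mem_Ioi, and_congr_right_iff]
          intro hx
          refine ⟨fun h => (hrq l).trans_lt h, fun h => ?_⟩
          by_contra hcon
          exact hl x ⟨h, not_lt.1 hcon⟩ hx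
        unfold tau1
        rw [this]
      have hTge : ((q : ℝ) : EReal) ≤ T := by
        refine ge_of_tendsto hTq (Eventually.of_forall fun l => ?_)
        refine le_sInf ?_
        rintro _ ⟨x, hx, rfl⟩
        exact_mod_cast (le_of_lt hx.2 : (q : ℝ) ≤ x)
      refine ⟨T - (t : EReal), ?_, ?_⟩
      · refine EReal.sub_pos.2 (lt_of_lt_of_le ?_ hTge)
        exact_mod_cast hq1
      · have hT' := hTq.congr' htau
        have hr' : Tendsto (fun l => -((r l : ℝ) : EReal)) atTop (𝓝 (-(t : EReal))) := by
          have : Tendsto (fun l => ((-(r l) : ℝ) : EReal)) atTop (𝓝 ((-t : ℝ) : EReal)) :=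
            (continuous_coe_real_ereal.tendsto _).comp hr.neg
          simpa using this
        have hcont : ContinuousAt (fun p : EReal × EReal => p.1 + p.2) (T, -(t : EReal)) := by
          apply EReal.continuousAt_add
          · right
            exact_mod_cast EReal.coe_ne_bot (-t)
          · right
            exact_mod_cast EReal.coe_ne_top (-t)
        exact hcont.tendsto.comp (hT'.prodMk_nhds hr')

theorem switching_signal_compactness
    {Γ : Type*} [MetricSpace Γ] [CompactSpace Γ]
    (τD : ℝ) (hτD : 0 < τD) (N₀ : ℕ)
    (σseq : ℕ → ℝ → Γ) (hσ : ∀ k, σseq k ∈ SA Γ τD N₀) :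
    ∃ φ : ℕ → ℕ, StrictMono φ ∧ ∃ σstar ∈ SA Γ τD N₀,
      (∀ᵐ t ∂(volume : Measure ℝ),
        Filter.Tendsto (fun l => σseq (φ l) t) Filter.atTop (nhds (σstar t))) ∧
      ∀ t : ℝ, ∃ r : ℕ → ℝ,
        Filter.Tendsto r Filter.atTop (nhds t) ∧
        Filter.Tendsto (fun l => σseq (φ l) (r l)) Filter.atTop (nhds (σstar t)) ∧
        ∃ L : EReal, 0 < L ∧
          Filter.Tendsto (fun l => tau1 (σseq (φ l)) (r l) - Real.toEReal (r l))
            Filter.atTop (nhds L) := by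
  let F : ℕ → ℚ → EReal × Γ := fun k q => (tau1 (σseq k) q, σseq k q)
  obtain ⟨a, φ, hφ, ha⟩ := SeqCompactSpace.tendsto_subseq F
  have ha' := tendsto_pi_nhds.1 ha
  refine ⟨φ, hφ, ?_⟩
  refine main_aux (fun l => σseq (φ l)) (fun q => ⟨(a q).1, ?_⟩) (fun q => ⟨(a q).2, ?_⟩)
    τD N₀ (fun k => hσ (φ k))
  · exact (continuous_fst.tendsto _).comp (ha' q)
  · exact (continuous_snd.tendsto _).comp (ha' q)
end
end

section
/- Let [a,b] ⊆ ℝ and, for each k ∈ ℕ, let σ_k : [a,b] → Γ be measurable and x_k : [a,b] → ℝⁿ be continuous with (x_k(t),σ_k(t)) ∈ dom(f) for all t ∈ [a,b] and x_k(t) = x_k(a) + ∫_a^t f(x_k(s),σ_k(s)) ds for all t ∈ [a,b] (i.e. x_k is absolutely continuous with ẋ_k(t) = f(x_k(t),σ_k(t)) for almost all t). Suppose there is a compact set B ⊆ ℝⁿ with x_k([a,b]) ⊆ B for all k, and a function σ : [a,b] → Γ with σ_k(t) → σ(t) for almost all t ∈ [a,b]. Then there exist a subsequence {x_{k_j}}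 and a continuous function x : [a,b] → ℝⁿ such that x_{k_j} → x uniformly on [a,b] and x(t) = x(a) + ∫_a^t f(x(s),σ(s)) ds for all t ∈ [a,b]. -/
open Filter Topology MeasureTheory Set

noncomputable section
theorem solutions_compactness_on_interval
    {n : ℕ} {Γ : Type*} [MetricSpace Γ] [CompactSpace Γ]
    [MeasurableSpace Γ] [BorelSpace Γ]
    (f : Eucl n × Γ → Eucl n) (domf : Set (Eucl n × Γ))
    (hdomf : IsClosed domf) (hf : ContinuousOn f domf)
    (a b : ℝ) (hab : a ≤ b)
    (xk : ℕ → ℝ → Eucl n) (σk : ℕ → ℝ → Γ)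
    (hmeas : ∀ k, Measurable (σk k))
    (hcont : ∀ k, ContinuousOn (xk k) (Set.Icc a b))
    (hmem : ∀ k, ∀ t ∈ Set.Icc a b, (xk k t, σk k t) ∈ domf)
    (hint : ∀ k, ∀ t ∈ Set.Icc a b,
      IntervalIntegrable (fun s => f (xk k s, σk k s)) volume a t ∧
      xk k t = xk k a + ∫ s in a..t, f (xk k s, σk k s))
    (B : Set (Eucl n)) (hB : IsCompact B)
    (hbd : ∀ k, ∀ t ∈ Set.Icc a b, xk k t ∈ B)
    (σ : ℝ → Γ)
    (hconv : ∀ᵐ t ∂(volume.restrict (Set.Icc a b)),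
      Filter.Tendsto (fun k => σk k t) Filter.atTop (nhds (σ t))) :
    ∃ φ : ℕ → ℕ, StrictMono φ ∧ ∃ x : ℝ → Eucl n,
      ContinuousOn x (Set.Icc a b) ∧
      TendstoUniformlyOn (fun j => xk (φ j)) x Filter.atTop (Set.Icc a b) ∧
      ∀ t ∈ Set.Icc a b,
        IntervalIntegrable (fun s => f (x s, σ s)) volume a t ∧
        x t = x a + ∫ s in a..t, f (x s, σ s) := by
  have hK : IsCompact (domf ∩ (B ×ˢ (Set.univ : Set Γ))) :=
    (hB.prod isCompact_univ).inter_left hdomf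
  obtain ⟨M₀, hM₀⟩ := hK.exists_bound_of_continuousOn (hf.mono Set.inter_subset_left)
  have hM : ∀ k, ∀ t ∈ Set.Icc a b, ‖f (xk k t, σk k t)‖ ≤ M₀ := fun k t ht =>
    hM₀ _ ⟨hmem k t ht, hbd k t ht, Set.mem_univ _⟩
  have hlip : ∀ k, ∀ s ∈ Set.Icc a b, ∀ t ∈ Set.Icc a b,
      dist (xk k s) (xk k t) ≤ M₀ * dist s t := by
    intro k s hs t ht
    have e : xk k s - xk k t = ∫ u in t..s, f (xk k u, σk k u) := by
      rw [← intervalIntegral.integral_interval_sub_left (hint k s hs).1 (hint k t ht).1]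
      conv_lhs => rw [(hint k s hs).2, (hint k t ht).2]
      abel
    rw [dist_eq_norm, e, Real.dist_eq]
    refine intervalIntegral.norm_integral_le_of_norm_le_const fun u hu => hM k u ?_
    exact Set.uIcc_subset_Icc ht hs (Set.uIoc_subset_uIcc hu)
  let F : ℕ → BoundedContinuousFunction (Set.Icc a b) (Eucl n) := fun k =>
    BoundedContinuousFunction.mkOfCompact ⟨_, (hcont k).restrict⟩
  have hF : ∀ k (t : Set.Icc a b), F k t = xk k t := fun k t => rfl
  have hcomp : IsCompact (closure (Set.range F)) := by
    refine BoundedContinuousFunction.arzela_ascoli B hB _ ?_ ?_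
    · rintro _ t ⟨k, rfl⟩
      exact hbd k t t.2
    · refine Metric.equicontinuous_of_continuity_modulus (fun r => M₀ * r) ?_ _ ?_
      · have : Tendsto (fun r : ℝ => M₀ * r) (𝓝 0) (𝓝 (M₀ * 0)) :=
          tendsto_const_nhds.mul tendsto_id
        simpa using this
      · rintro s t ⟨_, k, rfl⟩
        exact hlip k s s.2 t t.2
  obtain ⟨G, -, φ, hφ, hG⟩ := hcomp.tendsto_subseq (x := F)
    (fun k => subset_closure ⟨k, rfl⟩)
  rw [BoundedContinuousFunction.tendsto_iff_tendstoUniformly] at hG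
  have hxG : ∀ t (ht : t ∈ Set.Icc a b), Set.IccExtend hab G t = G ⟨t, ht⟩ := fun t ht =>
    Set.IccExtend_of_mem hab G ht
  have hunif : TendstoUniformlyOn (fun j => xk (φ j)) (Set.IccExtend hab G) atTop
      (Set.Icc a b) := by
    rw [Metric.tendstoUniformlyOn_iff]
    intro ε hε
    filter_upwards [Metric.tendstoUniformly_iff.1 hG ε hε] with j hj t ht
    rw [hxG t ht]
    exact hj ⟨t, ht⟩
  refine ⟨φ, hφ, Set.IccExtend hab G, (G.continuous.Icc_extend' (h := hab)).continuousOn,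
    hunif, ?_⟩
  intro t ht
  have hsub : Set.uIoc a t ⊆ Set.Icc a b := fun u hu =>
    Set.uIcc_subset_Icc ⟨le_rfl, hab⟩ ht (Set.uIoc_subset_uIcc hu)
  have hlim : ∀ᵐ s ∂(volume : Measure ℝ), s ∈ Set.uIoc a t →
      Tendsto (fun j => f (xk (φ j) s, σk (φ j) s)) atTop
        (𝓝 (f (Set.IccExtend hab G s, σ s))) := by
    filter_upwards [(ae_restrict_iff' measurableSet_Icc).1 hconv] with s hs hst
    have hsI := hsub hst
    have h1 : Tendsto (fun j => (xk (φ j) s, σk (φ j) s)) atTop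
        (𝓝 (Set.IccExtend hab G s, σ s)) :=
      (hunif.tendsto_at hsI).prodMk_nhds ((hs hsI).comp hφ.tendsto_atTop)
    have h2 : ∀ j, (xk (φ j) s, σk (φ j) s) ∈ domf := fun j => hmem _ s hsI
    have h3 := hdomf.mem_of_tendsto h1 (Eventually.of_forall h2)
    exact (hf _ h3).tendsto.comp
      (tendsto_nhdsWithin_iff.2 ⟨h1, Eventually.of_forall h2⟩)
  have hmeasj : ∀ j, AEStronglyMeasurable (fun s => f (xk (φ j) s, σk (φ j) s))
      (volume.restrict (Set.uIoc a t)) := fun j =>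
    (intervalIntegrable_iff.1 (hint (φ j) t ht).1).aestronglyMeasurable
  have hlim' := (ae_restrict_iff' (μ := (volume : Measure ℝ)) measurableSet_uIoc).2 hlim
  constructor
  · rw [intervalIntegrable_iff]
    have hfin : IsFiniteMeasure (volume.restrict (Set.uIoc a t)) :=
      ⟨by simp [Set.uIoc]⟩
    refine Integrable.of_bound (aestronglyMeasurable_of_tendsto_ae atTop hmeasj hlim') M₀ ?_
    filter_upwards [hlim', ae_restrict_mem measurableSet_uIoc] with s hs hst
    exact le_of_tendsto hs.norm (Eventually.of_forall fun j => hM _ s (hsub hst))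
  · have hI := intervalIntegral.tendsto_integral_filter_of_dominated_convergence
      (μ := volume) (fun _ => M₀) (Eventually.of_forall hmeasj)
      (Eventually.of_forall fun j => Eventually.of_forall fun s hs => hM (φ j) s (hsub hs))
      intervalIntegrable_const hlim
    have hL := hunif.tendsto_at ht
    have hR := (hunif.tendsto_at (⟨le_rfl, hab⟩ : a ∈ Set.Icc a b)).add hI
    refine tendsto_nhds_unique hL (hR.congr fun j => ?_)
    exact ((hint (φ j) t ht).2).symm
end
end

section
/- Let I be an interval of the form [a,b) or (−∞,b) with b ∈ ℝ or b = +∞, let τ_D > 0 and N₀ ∈ ℕ, and let {(x_k,σ_k)} be a uniformly precompact sequence of trajectories of the switched system ẋ = f(x,σ) such that σ_k ∈ S_a[τ_D,N₀] and I_{x_k} = I for all k. Then there exist a subsequence {(x_{k_l},σ_{k_l})} and a trajectory (x*,σ*) of the switched system with I_{x*} = I and σ* ∈ S_a[τ_D,N₀] such that: (1) x_{k_l} → x* uniformly on compact subsets of I; (2) σ_{k_l}(t) → σ*(t) for almost all t ∈ ℝ. -/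
open Filter Topology MeasureTheory Set

theorem aux_const {X : Type*} (g : ℝ → X) (p q : ℝ)
    (h : ∀ t ∈ Set.Ioo p q, ∀ᶠ s in 𝓝 t, g s = g t) :
    ∀ s ∈ Set.Ioo p q, ∀ s' ∈ Set.Ioo p q, g s = g s' := by
  intro s hs s' hs'
  refine (isPreconnected_Ioo (a := p) (b := q)).induction₂ (fun a b => g a = g b) ?_ ?_ ?_ hs hs'
  · intro x hx
    exact ((h x hx).filter_mono nhdsWithin_le_nhds).mono fun y hy => hy.symm
  · intro x y z _ _ _ h1 h2
    exact h1.trans h2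
  · intro x y _ _ h1
    exact h1.symm

theorem aux_signal_const {Γ : Type*} [MetricSpace Γ] (σ : ℝ → Γ) (hσ : IsSwitchingSignal σ)
    (p q : ℝ) (hJ : JumpTimes σ ∩ Set.Ioo p q = ∅) :
    ∀ s ∈ Set.Ioo p q, ∀ s' ∈ Set.Ioo p q, σ s = σ s' := by
  apply aux_const
  intro t ht
  have hc : ContinuousAt σ t := by
    by_contra hc
    have : t ∈ JumpTimes σ ∩ Set.Ioo p q := ⟨hc, ht⟩
    rw [hJ] at this
    exact this
  obtain ⟨ε, hε, hr⟩ := hσ.rightConst t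
  obtain ⟨δ, hδ, hl⟩ := hσ.leftConst t
  have hm : t - δ / 2 ∈ Set.Ioo (t - δ) t := ⟨by linarith, by linarith⟩
  have hlim : Tendsto σ (𝓝[<] t) (𝓝 (σ (t - δ / 2))) := by
    apply tendsto_const_nhds.congr'
    filter_upwards [Ioo_mem_nhdsLT (show t - δ < t by linarith)] with s hs
    exact hl _ hm _ hs
  have heq : σ (t - δ / 2) = σ t :=
    tendsto_nhds_unique hlim (hc.tendsto.mono_left nhdsWithin_le_nhds)
  filter_upwards [Ioo_mem_nhds (show t - δ < t by linarith) (show t < t + ε by linarith)] with s hs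
  rcases lt_or_ge s t with h | h
  · rw [← heq]; exact hl _ ⟨hs.1, h⟩ _ hm
  · exact hr s ⟨h, hs.2⟩

theorem aux_rat_nhds (t : ℝ) (U : Set ℝ) (hU : U ∈ 𝓝 t) :
    ∃ p q : ℚ, (p : ℝ) < t ∧ t < q ∧ Set.Ioo (p : ℝ) q ⊆ U := by
  obtain ⟨l, u, ht, hs⟩ := mem_nhds_iff_exists_Ioo_subset.1 hU
  obtain ⟨p, hp1, hp2⟩ := exists_rat_btwn ht.1
  obtain ⟨q, hq1, hq2⟩ := exists_rat_btwn ht.2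
  exact ⟨p, q, hp2, hq1, (Set.Ioo_subset_Ioo hp1.le hq2.le).trans hs⟩

theorem aux_signal_compact {Γ : Type*} [MetricSpace Γ] [CompactSpace Γ]
    (τD : ℝ) (N₀ : ℕ) (σk : ℕ → ℝ → Γ) (hσ : ∀ k, σk k ∈ SA Γ τD N₀) :
    ∃ φ : ℕ → ℕ, StrictMono φ ∧ ∃ σstar : ℝ → Γ, σstar ∈ SA Γ τD N₀ ∧
      (∀ t, ∃ ε > (0 : ℝ), ∀ s ∈ Set.Ioo t (t + ε),
        Tendsto (fun l => σk (φ l) s) atTop (𝓝 (σstar t))) ∧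
      ∀ᵐ t ∂(volume : Measure ℝ), Tendsto (fun l => σk (φ l) t) atTop (𝓝 (σstar t)) := by
  classical
  let b : ℕ → (ℚ → Γ) × (ℚ × ℚ → Bool) := fun k =>
    (fun q => σk k q, fun r => decide (JumpTimes (σk k) ∩ Set.Ioo (r.1 : ℝ) r.2).Nonempty)
  obtain ⟨lim, φ, hφ, hlim⟩ := CompactSpace.tendsto_subseq b
  have h1 : ∀ q : ℚ, Tendsto (fun l => σk (φ l) q) atTop (𝓝 (lim.1 q)) := fun q =>
    (tendsto_pi_nhds.1 ((continuous_fst.tendsto lim).comp hlim)) q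
  have h2 : ∀ r : ℚ × ℚ, Tendsto (fun l => (b (φ l)).2 r) atTop (𝓝 (lim.2 r)) := fun r =>
    (tendsto_pi_nhds.1 ((continuous_snd.tendsto lim).comp hlim)) r
  have hdich : ∀ p q : ℚ,
      (∀ᶠ l in atTop, (JumpTimes (σk (φ l)) ∩ Set.Ioo (p : ℝ) q).Nonempty) ∨
      (∀ᶠ l in atTop, JumpTimes (σk (φ l)) ∩ Set.Ioo (p : ℝ) q = ∅) := by
    intro p q
    have h := h2 (p, q)
    rw [nhds_discrete, tendsto_pure] at h
    cases hb : lim.2 (p, q) with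
    | true =>
      left
      filter_upwards [h] with l hl
      rw [hb] at hl
      exact of_decide_eq_true hl
    | false =>
      right
      filter_upwards [h] with l hl
      rw [hb] at hl
      exact Set.not_nonempty_iff_eq_empty.1 (of_decide_eq_false hl)
  set D : Set ℝ := {t | ∀ p q : ℚ, (p : ℝ) < t → t < q →
    ∀ᶠ l in atTop, (JumpTimes (σk (φ l)) ∩ Set.Ioo (p : ℝ) q).Nonempty} with hD
  have hcard : ∀ τ₁ τ₂ : ℝ, τ₁ < τ₂ → ∀ F : Finset ℝ, (F : Set ℝ) ⊆ D ∩ Set.Ioo τ₁ τ₂ →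
      (F.card : ℝ) ≤ (N₀ : ℝ) + (τ₂ - τ₁) / τD := by
    intro τ₁ τ₂ hτ F hF
    obtain ⟨U, hU, hdisj⟩ := F.finite_toSet.t2_separation
    have hev : ∀ᶠ l in atTop, ∀ t ∈ F,
        (JumpTimes (σk (φ l)) ∩ (U t ∩ Set.Ioo τ₁ τ₂)).Nonempty := by
      rw [Filter.eventually_all_finset]
      intro t ht
      have htD := hF ht
      obtain ⟨p, q, hp, hq, hs⟩ := aux_rat_nhds t (U t ∩ Set.Ioo τ₁ τ₂)
        (inter_mem ((hU t).2.mem_nhds (hU t).1) (Ioo_mem_nhds htD.2.1 htD.2.2))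
      filter_upwards [htD.1 p q hp hq] with l hl
      exact hl.mono (Set.inter_subset_inter_right _ hs)
    obtain ⟨l, hl⟩ := hev.exists
    choose! j hj using hl
    have hfin : (JumpTimes (σk (φ l)) ∩ Set.Ioo τ₁ τ₂).Finite :=
      ((hσ (φ l)).1.locFinite τ₁ τ₂).subset (Set.inter_subset_inter_right _ Set.Ioo_subset_Icc_self)
    have hle : (F : Set ℝ).ncard ≤ (JumpTimes (σk (φ l)) ∩ Set.Ioo τ₁ τ₂).ncard := by
      refine Set.ncard_le_ncard_of_injOn j ?_ ?_ hfin
      · intro t ht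
        exact ⟨(hj t ht).1, (hj t ht).2.2⟩
      · intro t ht s hs hts
        by_contra hne
        have := hdisj ht hs hne
        exact Set.disjoint_left.1 this (hj t ht).2.1 (hts ▸ (hj s hs).2.1)
    rw [Set.ncard_coe_finset] at hle
    exact le_trans (by exact_mod_cast hle) ((hσ (φ l)).2 τ₁ τ₂ hτ)
  have hDfin : ∀ τ₁ τ₂ : ℝ, τ₁ < τ₂ → (D ∩ Set.Ioo τ₁ τ₂).Finite := by
    intro τ₁ τ₂ hτ
    by_contra hinf
    obtain ⟨m, hm⟩ := exists_nat_gt ((N₀ : ℝ) + (τ₂ - τ₁) / τD)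
    obtain ⟨F, hF, hFc⟩ := Set.Infinite.exists_subset_card_eq hinf m
    have := hcard τ₁ τ₂ hτ F hF
    rw [hFc] at this
    linarith
  have hDncard : ∀ τ₁ τ₂ : ℝ, τ₁ < τ₂ →
      ((D ∩ Set.Ioo τ₁ τ₂).ncard : ℝ) ≤ (N₀ : ℝ) + (τ₂ - τ₁) / τD := by
    intro τ₁ τ₂ hτ
    have hf := hDfin τ₁ τ₂ hτ
    rw [Set.ncard_eq_toFinset_card _ hf]
    exact hcard τ₁ τ₂ hτ _ (by simp)
  -- local convergence off `D`
  have hloc : ∀ t, t ∉ D → ∃ γ : Γ, ∀ᶠ s in 𝓝 t, s ∉ D ∧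
      Tendsto (fun l => σk (φ l) s) atTop (𝓝 γ) := by
    intro t ht
    simp only [hD, Set.mem_setOf_eq, not_forall] at ht
    obtain ⟨p, q, hp, hq, hne⟩ := ht
    have hem := (hdich p q).resolve_left hne
    obtain ⟨r, hr1, hr2⟩ := exists_rat_btwn (hp.trans hq)
    refine ⟨lim.1 r, ?_⟩
    filter_upwards [Ioo_mem_nhds hp hq] with s hs
    refine ⟨fun hsD => hne (hsD p q hs.1 hs.2), (h1 r).congr' ?_⟩
    filter_upwards [hem] with l hl
    exact aux_signal_const _ (hσ (φ l)).1 p q hl r ⟨hr1, hr2⟩ s hs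
  have : Nonempty Γ := ⟨σk 0 0⟩
  choose! L hL using hloc
  have hLlim : ∀ t, t ∉ D → Tendsto (fun l => σk (φ l) t) atTop (𝓝 (L t)) := fun t ht =>
    (hL t ht).self_of_nhds.2
  have hLloc : ∀ t, t ∉ D → ∀ᶠ s in 𝓝 t, L s = L t := by
    intro t ht
    filter_upwards [hL t ht] with s hs
    exact tendsto_nhds_unique (hLlim s hs.1) hs.2
  have hLconst : ∀ p q : ℝ, D ∩ Set.Ioo p q = ∅ →
      ∀ s ∈ Set.Ioo p q, ∀ s' ∈ Set.Ioo p q, L s = L s' := by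
    intro p q hpq
    apply aux_const
    intro t ht
    exact hLloc t fun h => (hpq ▸ (⟨h, ht⟩ : t ∈ D ∩ Set.Ioo p q) : t ∈ (∅ : Set ℝ))
  -- punctured neighbourhoods
  have hpunct : ∀ t, ∃ ε > (0 : ℝ), D ∩ Set.Ioo t (t + ε) = ∅ ∧ D ∩ Set.Ioo (t - ε) t = ∅ := by
    intro t
    have hf : ((D ∩ Set.Ioo (t - 1) (t + 1)) \ {t}).Finite :=
      (hDfin (t - 1) (t + 1) (by linarith)).subset Set.diff_subset
    have hn : ((D ∩ Set.Ioo (t - 1) (t + 1)) \ {t})ᶜ ∈ 𝓝 t :=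
      hf.isClosed.isOpen_compl.mem_nhds (by simp)
    obtain ⟨ε, hε, hb⟩ := Metric.mem_nhds_iff.1 hn
    refine ⟨min ε 1, by positivity, ?_, ?_⟩
    · ext s
      simp only [Set.mem_inter_iff, Set.mem_Ioo, Set.mem_empty_iff_false, iff_false]
      rintro ⟨hsD, hs1, hs2⟩
      have e1 := min_le_left ε 1
      have e2 := min_le_right ε 1
      refine hb (show s ∈ Metric.ball t ε from ?_)
        ⟨⟨hsD, by linarith, by linarith⟩, fun h => hs1.ne' h⟩
      rw [Metric.mem_ball, Real.dist_eq, abs_lt]; constructor <;> linarith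
    · ext s
      simp only [Set.mem_inter_iff, Set.mem_Ioo, Set.mem_empty_iff_false, iff_false]
      rintro ⟨hsD, hs1, hs2⟩
      have e1 := min_le_left ε 1
      have e2 := min_le_right ε 1
      refine hb (show s ∈ Metric.ball t ε from ?_)
        ⟨⟨hsD, by linarith, by linarith⟩, fun h => hs2.ne h⟩
      rw [Metric.mem_ball, Real.dist_eq, abs_lt]; constructor <;> linarith
  choose ε hε hεr hεl using hpunct
  let σs : ℝ → Γ := fun t => L (t + ε t / 2)
  have hright : ∀ t, ∀ s ∈ Set.Ioo t (t + ε t), L s = σs t := by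
    intro t s hs
    have := hε t
    exact hLconst _ _ (hεr t) s hs _ ⟨by linarith, by linarith⟩
  have hoff : ∀ t, t ∉ D → σs t = L t := by
    intro t ht
    have e1 : ∀ᶠ s in 𝓝[>] t, L s = L t := (hLloc t ht).filter_mono nhdsWithin_le_nhds
    have e2 : ∀ᶠ s in 𝓝[>] t, s ∈ Set.Ioo t (t + ε t) :=
      Ioo_mem_nhdsGT (by have := hε t; linarith)
    obtain ⟨s, hs1, hs2⟩ := (e1.and e2).exists
    rw [← hright t s hs2, hs1]
  have hnot : ∀ p q : ℝ, D ∩ Set.Ioo p q = ∅ → ∀ s ∈ Set.Ioo p q, s ∉ D := by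
    intro p q h s hs hsD
    exact (h ▸ (⟨hsD, hs⟩ : s ∈ D ∩ Set.Ioo p q) : s ∈ (∅ : Set ℝ))
  have hJD : JumpTimes σs ⊆ D := by
    intro t ht
    by_contra htD
    apply ht
    have : ∀ᶠ s in 𝓝 t, σs s = σs t := by
      filter_upwards [hL t htD, hLloc t htD] with s hs hs2
      rw [hoff s hs.1, hoff t htD, hs2]
    exact tendsto_const_nhds.congr' (this.mono fun s hs => hs.symm)
  have hDc : D.Countable := by
    have : D = ⋃ m : ℕ, D ∩ Set.Ioo (-((m : ℝ) + 1)) (m + 1) := by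
      rw [← Set.inter_iUnion]
      symm
      rw [Set.inter_eq_left]
      intro t _
      obtain ⟨m, hm⟩ := exists_nat_gt |t|
      rw [Set.mem_iUnion]
      have := abs_lt.1 hm
      exact ⟨m, by linarith [this.1], by linarith [this.2]⟩
    rw [this]
    exact Set.countable_iUnion fun m => (hDfin _ _ (by
      have : (0 : ℝ) ≤ m := Nat.cast_nonneg m
      linarith)).countable
  refine ⟨φ, hφ, σs, ⟨⟨?_, ?_, ?_⟩, ?_⟩, ?_, ?_⟩
  · intro a c
    rcases le_or_gt a c with hac | hac
    · refine (hDfin (a - 1) (c + 1) (by linarith)).subset ?_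
      rintro s ⟨hs, hs1, hs2⟩
      exact ⟨hJD hs, by linarith, by linarith⟩
    · rw [Set.Icc_eq_empty (not_le.2 hac)]; simp
  · intro t
    refine ⟨ε t, hε t, fun s hs => ?_⟩
    rcases hs.1.eq_or_lt with h | h
    · rw [h]
    · rw [hoff s (hnot _ _ (hεr t) s ⟨h, hs.2⟩), hright t s ⟨h, hs.2⟩]
  · intro t
    refine ⟨ε t, hε t, fun s hs s' hs' => ?_⟩
    rw [hoff s (hnot _ _ (hεl t) s hs), hoff s' (hnot _ _ (hεl t) s' hs')]
    exact hLconst _ _ (hεl t) s hs s' hs'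
  · intro τ₁ τ₂ hτ
    refine le_trans ?_ (hDncard τ₁ τ₂ hτ)
    exact_mod_cast Set.ncard_le_ncard (Set.inter_subset_inter_left _ hJD) (hDfin τ₁ τ₂ hτ)
  · intro t
    refine ⟨ε t, hε t, fun s hs => ?_⟩
    rw [← hright t s hs]
    exact hLlim s (hnot _ _ (hεr t) s hs)
  · filter_upwards [hDc.ae_notMem volume] with t ht
    rw [hoff t ht]
    exact hLlim t ht

theorem aux_ascoli {n : ℕ} (I : Set ℝ) (hne : I.Nonempty)
    (hI : ∀ t ∈ I, ∃ ε > (0 : ℝ), Set.Ico t (t + ε) ⊆ I)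
    (x : ℕ → ℝ → Eucl n) (B : Set (Eucl n)) (hB : IsCompact B)
    (hbd : ∀ k, ∀ t ∈ I, x k t ∈ B) (M : ℝ) (hM : 0 < M)
    (hlip : ∀ k, ∀ t ∈ I, ∀ s ∈ I, dist (x k t) (x k s) ≤ M * |t - s|) :
    ∃ φ : ℕ → ℕ, StrictMono φ ∧ ∃ y : ℝ → Eucl n,
      (∀ t ∈ I, Tendsto (fun l => x (φ l) t) atTop (𝓝 (y t))) ∧
      (∀ t ∈ I, ∀ s ∈ I, dist (y t) (y s) ≤ M * |t - s|) ∧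
      ∀ K : Set ℝ, K ⊆ I → IsCompact K →
        TendstoUniformlyOn (fun l => x (φ l)) y atTop K := by
  classical
  obtain ⟨t₀, ht₀⟩ := hne
  have : CompactSpace B := isCompact_iff_compactSpace.1 hB
  let g : ℕ → ℚ → B := fun k q =>
    if h : (q : ℝ) ∈ I then ⟨x k q, hbd k q h⟩ else ⟨x k t₀, hbd k t₀ ht₀⟩
  obtain ⟨lim, φ, hφ, hlim⟩ := CompactSpace.tendsto_subseq g
  have h1 : ∀ q : ℚ, (q : ℝ) ∈ I → Tendsto (fun l => x (φ l) q) atTop (𝓝 (lim q : Eucl n)) := by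
    intro q hq
    have h := (continuous_subtype_val.tendsto (lim q)).comp (tendsto_pi_nhds.1 hlim q)
    refine h.congr fun l => ?_
    simp [g, hq]
  have hcau : ∀ t ∈ I, CauchySeq (fun l => x (φ l) t) := by
    intro t ht
    rw [Metric.cauchySeq_iff]
    intro ε hε
    obtain ⟨δ, hδ, hsub⟩ := hI t ht
    obtain ⟨q, hq1, hq2⟩ := exists_rat_btwn
      (show t < t + min δ (ε / (4 * M)) by have : 0 < min δ (ε / (4 * M)) := by positivity
                                           linarith)
    have e1 := min_le_left δ (ε / (4 * M))
    have e2 := min_le_right δ (ε / (4 * M))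
    have hqI : (q : ℝ) ∈ I := hsub ⟨hq1.le, by linarith⟩
    have hdq : M * |t - q| ≤ ε / 4 := by
      have : |t - q| ≤ ε / (4 * M) := by rw [abs_le]; constructor <;> linarith
      calc M * |t - q| ≤ M * (ε / (4 * M)) := by gcongr
        _ = ε / 4 := by field_simp
    obtain ⟨N, hN⟩ := Metric.cauchySeq_iff.1 (h1 q hqI).cauchySeq (ε / 4) (by positivity)
    refine ⟨N, fun m hm l hl => ?_⟩
    have a1 := hlip (φ m) t ht q hqI
    have a2 := hlip (φ l) t ht q hqI
    have a3 := hN m hm l hl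
    have a4 := dist_triangle4_right (x (φ m) t) (x (φ l) t) (x (φ m) q) (x (φ l) q)
    linarith
  have hex : ∀ t, ∃ y, t ∈ I → Tendsto (fun l => x (φ l) t) atTop (𝓝 y) := by
    intro t
    by_cases ht : t ∈ I
    · obtain ⟨y, hy⟩ := cauchySeq_tendsto_of_complete (hcau t ht)
      exact ⟨y, fun _ => hy⟩
    · exact ⟨0, fun h => absurd h ht⟩
  choose y hy using hex
  have hylip : ∀ t ∈ I, ∀ s ∈ I, dist (y t) (y s) ≤ M * |t - s| := fun t ht s hs =>
    le_of_tendsto ((hy t ht).dist (hy s hs)) (Eventually.of_forall fun l => hlip _ t ht s hs)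
  refine ⟨φ, hφ, y, hy, hylip, fun K hK hKc => ?_⟩
  rw [← tendstoLocallyUniformlyOn_iff_tendstoUniformlyOn_of_compact hKc,
    Metric.tendstoLocallyUniformlyOn_iff]
  intro ε hε t ht
  refine ⟨Metric.ball t (ε / (3 * M)) ∩ K, inter_mem
    (mem_nhdsWithin_of_mem_nhds (Metric.ball_mem_nhds t (by positivity))) self_mem_nhdsWithin, ?_⟩
  filter_upwards [Metric.tendsto_nhds.1 (hy t (hK ht)) (ε / 3) (by positivity)] with l hl s hs
  have hd : M * |s - t| < ε / 3 := by
    have h := hs.1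
    rw [Metric.mem_ball, Real.dist_eq] at h
    calc M * |s - t| < M * (ε / (3 * M)) := by gcongr
      _ = ε / 3 := by field_simp
  have a1 := hlip (φ l) s (hK hs.2) t (hK ht)
  have a2 := hylip s (hK hs.2) t (hK ht)
  have a4 := dist_triangle4_right (y s) (x (φ l) s) (y t) (x (φ l) t)
  rw [dist_comm (y t)] at a4
  linarith

noncomputable section
theorem trajectory_compactness_on_halfopen_interval
    {n : ℕ} {Γ : Type*} [MetricSpace Γ] [CompactSpace Γ]
    (f : Eucl n × Γ → Eucl n) (domf : Set (Eucl n × Γ))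
    (hdomf : IsClosed domf) (hf : ContinuousOn f domf)
    (I : Set ℝ)
    (hI : (∃ a b : ℝ, I = Set.Ico a b) ∨ (∃ a : ℝ, I = Set.Ici a) ∨
          (∃ b : ℝ, I = Set.Iio b) ∨ I = Set.univ)
    (τD : ℝ) (hτD : 0 < τD) (N₀ : ℕ)
    (xk : ℕ → ℝ → Eucl n) (σk : ℕ → ℝ → Γ)
    (htraj : ∀ k, IsTrajectory f domf (xk k) (σk k) I)
    (hσ : ∀ k, σk k ∈ SA Γ τD N₀)
    (B : Set (Eucl n)) (hB : IsCompact B)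
    (hbd : ∀ k, ∀ t ∈ I, xk k t ∈ B) :
    ∃ φ : ℕ → ℕ, StrictMono φ ∧ ∃ xstar : ℝ → Eucl n, ∃ σstar : ℝ → Γ,
      IsTrajectory f domf xstar σstar I ∧ σstar ∈ SA Γ τD N₀ ∧
      (∀ K : Set ℝ, K ⊆ I → IsCompact K →
        TendstoUniformlyOn (fun l => xk (φ l)) xstar Filter.atTop K) ∧
      ∀ᵐ t ∂(volume : Measure ℝ),
        Filter.Tendsto (fun l => σk (φ l) t) Filter.atTop (nhds (σstar t)) := by
  have hIne : I.Nonempty := (htraj 0).nonempty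
  have hIoc : I.OrdConnected := (htraj 0).ordConn
  have hIr : ∀ t ∈ I, ∃ ε > (0 : ℝ), Set.Ico t (t + ε) ⊆ I := by
    intro t ht
    rcases hI with ⟨a, b, rfl⟩ | ⟨a, rfl⟩ | ⟨b, rfl⟩ | rfl
    · exact ⟨b - t, sub_pos.2 ht.2, fun s hs => ⟨ht.1.trans hs.1, by linarith [hs.2]⟩⟩
    · exact ⟨1, one_pos, fun s hs => le_trans ht hs.1⟩
    · exact ⟨b - t, sub_pos.2 ht, fun s hs => by
        have := hs.2
        simp only [Set.mem_Iio]; linarith⟩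
    · exact ⟨1, one_pos, fun s _ => Set.mem_univ s⟩
  -- a uniform bound on the vector field
  have hKc : IsCompact (domf ∩ (B ×ˢ (Set.univ : Set Γ))) :=
    (hB.prod isCompact_univ).inter_left hdomf
  obtain ⟨M₀, hM₀⟩ := hKc.exists_bound_of_continuousOn (hf.mono Set.inter_subset_left)
  obtain ⟨M, hM, hfM⟩ : ∃ M : ℝ, 0 < M ∧ ∀ p ∈ domf ∩ (B ×ˢ (Set.univ : Set Γ)), ‖f p‖ ≤ M :=
    ⟨max M₀ 1, by positivity, fun p hp => (hM₀ p hp).trans (le_max_left _ _)⟩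
  have hfk : ∀ k, ∀ t ∈ I, ‖f (xk k t, σk k t)‖ ≤ M := fun k t ht =>
    hfM _ ⟨(htraj k).mem t ht, hbd k t ht, Set.mem_univ _⟩
  have huI : ∀ t₀ ∈ I, ∀ t ∈ I, Set.uIoc t₀ t ⊆ I := fun t₀ ht₀ t ht =>
    Set.uIoc_subset_uIcc.trans (hIoc.uIcc_subset ht₀ ht)
  have hlip : ∀ k, ∀ t ∈ I, ∀ s ∈ I, dist (xk k t) (xk k s) ≤ M * |t - s| := by
    intro k t ht s hs
    rw [dist_eq_norm, ((htraj k).intg s hs t ht).2, add_sub_cancel_left]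
    exact intervalIntegral.norm_integral_le_of_norm_le_const fun r hr =>
      hfk k r (huI s hs t ht hr)
  obtain ⟨φ, hφ, σs, hσs, hσr, hσae⟩ := aux_signal_compact τD N₀ σk hσ
  obtain ⟨ψ, hψ, y, hy, hylip, hyu⟩ := aux_ascoli I hIne hIr (fun k => xk (φ k)) B hB
    (fun k => hbd (φ k)) M hM (fun k => hlip (φ k))
  have hycont : ContinuousOn y I := by
    have : LipschitzOnWith (Real.toNNReal M) y I := by
      refine LipschitzOnWith.of_dist_le_mul fun t ht s hs => ?_
      rw [Real.coe_toNNReal _ hM.le, Real.dist_eq]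
      exact hylip t ht s hs
    exact this.continuousOn
  have hσae' : ∀ᵐ t ∂(volume : Measure ℝ),
      Tendsto (fun l => σk (φ (ψ l)) t) atTop (𝓝 (σs t)) :=
    hσae.mono fun t ht => ht.comp hψ.tendsto_atTop
  have hmem : ∀ t ∈ I, (y t, σs t) ∈ domf := by
    intro t ht
    obtain ⟨ε, hε, hε'⟩ := hσr t
    obtain ⟨δ, hδ, hδ'⟩ := hIr t ht
    have hcl : ∀ᶠ s in 𝓝[>] t, (y s, σs t) ∈ domf ∧ s ∈ I := by
      filter_upwards [Ioo_mem_nhdsGT (show t < t + ε by linarith),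
        Ioo_mem_nhdsGT (show t < t + δ by linarith)] with s hs1 hs2
      have hsI : s ∈ I := hδ' ⟨hs2.1.le, hs2.2⟩
      refine ⟨hdomf.mem_of_tendsto ((hy s hsI).prodMk_nhds
        ((hε' s hs1).comp hψ.tendsto_atTop)) (Eventually.of_forall fun l => ?_), hsI⟩
      exact (htraj (φ (ψ l))).mem s hsI
    have hty : Tendsto y (𝓝[>] t) (𝓝 (y t)) := by
      refine (hycont t ht).tendsto.comp (tendsto_nhdsWithin_iff.2
        ⟨nhdsWithin_le_nhds, hcl.mono fun s hs => hs.2⟩) 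
    exact hdomf.mem_of_tendsto (hty.prodMk_nhds tendsto_const_nhds) (hcl.mono fun s hs => hs.1)
  refine ⟨φ ∘ ψ, hφ.comp hψ, y, σs, ⟨hσs.1, hIne, hIoc, hycont, hmem, ?_⟩, hσs, hyu, hσae'⟩
  intro t₀ ht₀ t ht
  have hsub := huI t₀ ht₀ t ht
  have hyB : ∀ s ∈ I, y s ∈ B := fun s hs =>
    hB.isClosed.mem_of_tendsto (hy s hs) (Eventually.of_forall fun l => hbd _ s hs)
  have hlimf : ∀ᵐ s ∂(volume : Measure ℝ), s ∈ Set.uIoc t₀ t →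
      Tendsto (fun l => f (xk (φ (ψ l)) s, σk (φ (ψ l)) s)) atTop (𝓝 (f (y s, σs s))) := by
    filter_upwards [hσae'] with s hs hst
    have hsI := hsub hst
    refine (hf _ (hmem s hsI)).tendsto.comp (tendsto_nhdsWithin_iff.2
      ⟨(hy s hsI).prodMk_nhds hs, Eventually.of_forall fun l => ?_⟩)
    exact (htraj (φ (ψ l))).mem s hsI
  have hmeas : ∀ l, AEStronglyMeasurable (fun s => f (xk (φ (ψ l)) s, σk (φ (ψ l)) s))
      (volume.restrict (Set.uIoc t₀ t)) := fun l =>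
    (intervalIntegrable_iff.1 ((htraj (φ (ψ l))).intg t₀ ht₀ t ht).1).aestronglyMeasurable
  have hmeas' : AEStronglyMeasurable (fun s => f (y s, σs s))
      (volume.restrict (Set.uIoc t₀ t)) :=
    aestronglyMeasurable_of_tendsto_ae atTop hmeas
      ((ae_restrict_iff' measurableSet_uIoc).2 hlimf)
  have hint : IntervalIntegrable (fun s => f (y s, σs s)) volume t₀ t := by
    refine (intervalIntegrable_const (c := M)).mono_fun hmeas' ?_
    refine (ae_restrict_iff' measurableSet_uIoc).2 (Eventually.of_forall fun s hs => ?_)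
    have hsI := hsub hs
    exact (hfM _ ⟨hmem s hsI, hyB s hsI, Set.mem_univ _⟩).trans (le_abs_self M)
  refine ⟨hint, ?_⟩
  have hT : Tendsto (fun l => ∫ s in t₀..t, f (xk (φ (ψ l)) s, σk (φ (ψ l)) s)) atTop
      (𝓝 (∫ s in t₀..t, f (y s, σs s))) :=
    intervalIntegral.tendsto_integral_filter_of_dominated_convergence (fun _ => M)
      (Eventually.of_forall hmeas)
      (Eventually.of_forall fun l => Eventually.of_forall fun s hs => hfk _ s (hsub hs))
      intervalIntegrable_const hlimf
  refine tendsto_nhds_unique (hy t ht) (((hy t₀ ht₀).add hT).congr fun l => ?_)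
  exact ((htraj (φ (ψ l))).intg t₀ ht₀ t ht).2.symm
end
end
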